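/- Let 𝓕 be a countable class of functions f: ℝ → ℝ each satisfying condition (f), and let Λ ≥ 0 be a real number. Then there exists a strictly increasing sequence of positive integers (n_k)_{k≥1} with n_{k+1} − n_k ∈ {1,2} for all k ≥ 1 such that for every f ∈ 𝓕, limsup_{N→∞} |∑_{k=1}^N f(n_k x)| / √(N log log N) = Λ‖f‖ for almost every real number x. -/

import Mathlib

open MeasureTheory Filter Finset Real

/-- The `L²(0,1)` norm of a function. -/
noncomputable def L2norm (f : ℝ → ℝ) : ℝ :=
  Real.sqrt (∫ x in (0:ℝ)..1, (f x) ^ 2)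


/-- A 1-periodic function dominated by a monotone quasi-periodic function. -/
structure GoodFn (f v : ℝ → ℝ) (V : ℝ) : Prop where
  per : ∀ x, f (x + 1) = f x
  vper : ∀ x, v (x + 1) = v x + V
  dom : ∀ a b, a ≤ b → |f b - f a| ≤ v b - v a

lemma GoodFn.exists_of_bv {f : ℝ → ℝ} (hp : ∀ x, f (x + 1) = f x)
    (hb : BoundedVariationOn f (Set.Icc 0 1)) : ∃ v V, GoodFn f v V := by
  have hl := hb.locallyBoundedVariationOn
  set v0 : ℝ → ℝ := fun t => variationOnFromTo f (Set.Icc 0 1) 0 t with hv0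
  have key : ∀ u w, 0 ≤ u → u ≤ w → w ≤ 1 → |f w - f u| ≤ v0 w - v0 u := by
    intro u w h0 h1 h2
    have h0' : (0:ℝ) ∈ Set.Icc (0:ℝ) 1 := by simp
    have hu : u ∈ Set.Icc (0:ℝ) 1 := ⟨h0, h1.trans h2⟩
    have hw : w ∈ Set.Icc (0:ℝ) 1 := ⟨h0.trans h1, h2⟩
    have hadd := variationOnFromTo.add hl h0' hu hw
    have e1 := variationOnFromTo.eq_of_le f (Set.Icc (0:ℝ) 1) h1
    have e2 : edist (f w) (f u) ≤ eVariationOn f (Set.Icc 0 1 ∩ Set.Icc u w) :=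
      eVariationOn.edist_le f ⟨hw, h1, le_rfl⟩ ⟨hu, le_rfl, h1⟩
    have e3 := hl u w hu hw
    have e4 := ENNReal.toReal_mono e3 e2
    rw [← e1, edist_dist, ENNReal.toReal_ofReal dist_nonneg, Real.dist_eq] at e4
    simp only [hv0]
    linarith
  have fper : ∀ x, f (Int.fract x) = f x := by
    intro x
    have : Function.Periodic f 1 := hp
    have := this.sub_zsmul_eq (x := x) ⌊x⌋
    simp only [zsmul_eq_mul, mul_one] at this
    rw [← this]; rfl
  have f10 : f 1 = f 0 := by have := hp 0; simpa using this
  have v00 : v0 0 = 0 := variationOnFromTo.self f (Set.Icc 0 1) 0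
  refine ⟨fun x => v0 (Int.fract x) + ⌊x⌋ * v0 1, v0 1, hp, ?_, ?_⟩
  · intro x
    simp only [Int.fract_add_one, Int.floor_add_one]
    push_cast; ring
  · intro a b hab
    have hV : 0 ≤ v0 1 := by
      have := key 0 1 le_rfl zero_le_one le_rfl
      have := (abs_nonneg _).trans this
      linarith
    have hf : ⌊a⌋ ≤ ⌊b⌋ := Int.floor_le_floor hab
    rw [← fper a, ← fper b]
    rcases hf.eq_or_lt with h | h
    · have : Int.fract a ≤ Int.fract b := by
        unfold Int.fract; rw [h]; linarith
      have := key _ _ (Int.fract_nonneg a) this (Int.fract_lt_one b).le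
      rw [h]; linarith
    · have h1 := key _ _ (Int.fract_nonneg a) (Int.fract_lt_one a).le le_rfl
      have h2 := key _ _ le_rfl (Int.fract_nonneg b) (Int.fract_lt_one b).le
      have h3 : ((⌊a⌋ + 1 : ℤ) : ℝ) ≤ (⌊b⌋ : ℤ) := by exact_mod_cast h
      have h4 : 0 ≤ ((⌊b⌋ : ℝ) - ((⌊a⌋ : ℝ) + 1)) * v0 1 := by
        push_cast at h3
        exact mul_nonneg (by linarith) hV
      have h5 : |f (Int.fract b) - f (Int.fract a)| ≤ |f (Int.fract b) - f 0| + |f 1 - f (Int.fract a)| := by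
        rw [f10]; exact abs_sub_le _ _ _
      nlinarith

namespace GoodFn
variable {f v : ℝ → ℝ} {V : ℝ}

lemma mono (h : GoodFn f v V) : Monotone v := fun a b hab => by
  have := (abs_nonneg _).trans (h.dom a b hab); linarith

lemma V_nonneg (h : GoodFn f v V) : 0 ≤ V := by
  have := h.vper 0
  have := h.mono (show (0:ℝ) ≤ 0 + 1 by norm_num)
  linarith

lemma periodic (h : GoodFn f v V) : Function.Periodic f 1 := h.per

lemma add_int (h : GoodFn f v V) (x : ℝ) (m : ℤ) : f (x + m) = f x := by
  have := h.periodic.zsmul m x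
  simpa using this

lemma v_add_nat (h : GoodFn f v V) (x : ℝ) (m : ℕ) : v (x + m) = v x + m * V := by
  induction m with
  | zero => simp
  | succ k ih =>
    have := h.vper (x + k)
    push_cast
    rw [← add_assoc, this, ih]; ring

lemma bdd (h : GoodFn f v V) (x : ℝ) : |f x| ≤ |f 0| + V := by
  have e : f (Int.fract x) = f x := by
    have := h.add_int (Int.fract x) ⌊x⌋
    rw [← this, Int.fract_add_floor]
  have h1 := h.dom 0 (Int.fract x) (Int.fract_nonneg x)
  have h2 := h.mono (Int.fract_lt_one x).le
  have h3 := h.vper 0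
  rw [zero_add] at h3
  have := abs_sub_abs_le_abs_sub (f (Int.fract x)) (f 0)
  rw [e] at *
  linarith

lemma mono_add (h : GoodFn f v V) : Monotone (fun x => v x + f x) := fun a b hab => by
  have := abs_le.1 (h.dom a b hab)
  show v a + f a ≤ v b + f b
  linarith [this.1]

lemma measurable (h : GoodFn f v V) : Measurable f := by
  have : f = fun x => (v x + f x) - v x := by ext; ring
  rw [this]
  exact h.mono_add.measurable.sub h.mono.measurable

lemma intervalIntegrable (h : GoodFn f v V) (a b : ℝ) : IntervalIntegrable f volume a b := by
  have : f = fun x => (v x + f x) - v x := by ext; ring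
  rw [this]
  exact (h.mono_add.monotoneOn _).intervalIntegrable.sub (h.mono.monotoneOn _).intervalIntegrable

lemma sq_sub (h : GoodFn f v V) (c : ℝ) :
    GoodFn (fun x => f x ^ 2 - c) (fun x => 2 * (|f 0| + V) * v x) (2 * (|f 0| + V) * V) := by
  refine ⟨fun x => by simp [h.per], fun x => by simp [h.vper]; ring, fun a b hab => ?_⟩
  have e : f b ^ 2 - c - (f a ^ 2 - c) = (f b + f a) * (f b - f a) := by ring
  rw [e, abs_mul, ← mul_sub]
  have h1 := h.bdd a
  have h2 := h.bdd b
  have h3 := abs_add_le (f b) (f a)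
  exact mul_le_mul (by linarith) (h.dom a b hab) (abs_nonneg _) (by linarith [abs_nonneg (f a)])

lemma reindex {h : ℝ → ℝ} (hp : Function.Periodic h 1) (p : ℤ) (q : ℕ) (hq : 0 < q)
    (hc : IsCoprime p (q:ℤ)) :
    ∑ n ∈ range q, h (n * (p / q)) = ∑ j ∈ range q, h (j / q) := by
  have hq' : (0:ℤ) < q := by exact_mod_cast hq
  have hqr : (0:ℝ) < q := by exact_mod_cast hq
  set φ : ℕ → ℕ := fun n => ((n * p) % q : ℤ).toNat with hφ
  have hφ' : ∀ n, ((φ n : ℕ) : ℤ) = (n * p) % q := fun n =>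
    Int.toNat_of_nonneg (Int.emod_nonneg _ hq'.ne')
  have hmem : ∀ n, φ n ∈ range q := by
    intro n
    rw [mem_range]
    have := Int.emod_lt_of_pos (n * p) hq'
    rw [← hφ'] at this
    exact_mod_cast this
  have hinj : Set.InjOn φ (range q) := by
    intro a ha b hb hab
    simp only [coe_range, Set.mem_Iio] at ha hb
    have h1 : ((a:ℤ) * p) % q = (b * p) % q := by rw [← hφ', ← hφ', hab]
    have h2 : (q:ℤ) ∣ (a - b) * p := by
      have := Int.emod_emod_of_dvd
      have h3 := Int.ModEq.dvd (show (b * p : ℤ) ≡ a * p [ZMOD q] from h1.symm)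
      convert h3 using 1; ring
    have h3 : (q:ℤ) ∣ a - b := (hc.symm).dvd_of_dvd_mul_right h2
    have h4 := Int.eq_zero_of_abs_lt_dvd h3 (by rw [abs_lt]; omega)
    omega
  refine Finset.sum_nbij φ (fun a _ => hmem a) hinj ?_ ?_
  · exact Finset.surjOn_of_injOn_of_card_le φ (fun a _ => hmem a) hinj le_rfl
  · intro n _
    have h1 := Int.emod_add_mul_ediv (n * p) q
    rw [← hφ'] at h1
    have h2 : (n:ℝ) * p = φ n + q * ((n * p / q : ℤ) : ℝ) := by exact_mod_cast h1.symm
    have h3 : (n:ℝ) * (p / q) = φ n / q + ((n * p / q : ℤ) : ℝ) := by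
      rw [← mul_div_assoc, h2]; field_simp
    rw [h3]
    have := hp.zsmul (n * p / q : ℤ) ((φ n : ℝ) / q)
    simpa using this

/-- Denjoy-Koksma. -/
lemma denjoy_koksma (h : GoodFn f v V) (h0 : ∫ x in (0:ℝ)..1, f x = 0) (x y : ℝ) (p : ℤ) (q : ℕ)
    (hq : 0 < q) (hc : IsCoprime p (q:ℤ)) (hx : |x - p / q| ≤ 1 / q ^ 2) :
    |∑ n ∈ range q, f (y + n * x)| ≤ 2 * V := by
  have hqr : (0:ℝ) < q := by exact_mod_cast hq
  set I : ℝ → ℝ := fun t => q * ∫ u in (y + t)..(y + t + 1 / q), f u with hI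
  set D : ℝ → ℝ := fun t => v (y + t + 1 / q) - v (y + t - 1 / q) with hD
  have hIp : Function.Periodic I 1 := by
    intro t
    simp only [hI]
    congr 1
    have := intervalIntegral.integral_comp_add_right (a := y + t) (b := y + t + 1 / q) f 1
    simp only [h.per] at this
    rw [this]; congr 1 <;> ring
  have hDp : Function.Periodic D 1 := by
    intro t
    simp only [hD]
    have h1 := h.vper (y + t + 1 / q)
    have h2 := h.vper (y + t - 1 / q)
    rw [show y + (t + 1) + 1 / (q:ℝ) = y + t + 1 / q + 1 by ring,
      show y + (t + 1) - 1 / (q:ℝ) = y + t - 1 / q + 1 by ring, h1, h2]; ring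
  have hterm : ∀ n ∈ range q, |f (y + n * x) - I (n * (p / q))| ≤ D (n * (p / q)) := by
    intro n hn
    rw [mem_range] at hn
    set t : ℝ := n * (p / q) with ht
    have hn' : (n:ℝ) ≤ q := by exact_mod_cast hn.le
    have hclose : |n * x - t| ≤ 1 / q := by
      rw [ht, ← mul_sub, abs_mul, abs_of_nonneg (Nat.cast_nonneg n)]
      calc (n:ℝ) * |x - p / q| ≤ q * (1 / q ^ 2) := by gcongr
        _ = 1 / q := by field_simp
    have hcl := abs_le.1 hclose
    have e : f (y + n * x) - I t = q * ∫ u in (y + t)..(y + t + 1 / q), (f (y + n * x) - f u) := by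
      rw [intervalIntegral.integral_sub (by simp) (h.intervalIntegrable _ _)]
      simp only [hI, intervalIntegral.integral_const, smul_eq_mul]
      field_simp; ring
    rw [e, abs_mul, abs_of_pos hqr]
    have hb : ‖∫ u in (y + t)..(y + t + 1 / q), (f (y + n * x) - f u)‖ ≤ D t * |y + t + 1 / q - (y + t)| := by
      apply intervalIntegral.norm_integral_le_of_norm_le_const
      intro u hu
      rw [Set.uIoc_of_le (by simp)] at hu
      rw [Real.norm_eq_abs]
      rcases le_total u (y + n * x) with hle | hle
      · have := h.dom _ _ hle
        have h1 := h.mono (show y + n * x ≤ y + t + 1 / q by linarith)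
        have h2 := h.mono (show y + t - 1 / q ≤ u by linarith [hu.1, one_div_pos.2 hqr])
        simp only [hD]; linarith
      · have := h.dom _ _ hle
        rw [abs_sub_comm] at this
        have h1 := h.mono hu.2
        have h2 := h.mono (show y + t - 1 / q ≤ y + n * x by linarith)
        simp only [hD]; linarith
    rw [Real.norm_eq_abs, add_sub_cancel_left, abs_of_pos (one_div_pos.2 hqr)] at hb
    calc (q:ℝ) * _ ≤ q * (D t * (1 / q)) := by gcongr
      _ = D t := by field_simp
  have hsumI : ∑ n ∈ range q, I (n * (p / q)) = 0 := by
    rw [reindex hIp p q hq hc]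
    simp only [hI, ← Finset.mul_sum]
    have := intervalIntegral.sum_integral_adjacent_intervals (f := f) (μ := volume)
      (a := fun k : ℕ => y + k / q) (n := q) (fun k _ => h.intervalIntegrable _ _)
    have e : ∀ k : ℕ, y + ((k + 1 : ℕ) : ℝ) / q = y + k / q + 1 / q := by
      intro k; push_cast; ring
    simp only [e] at this
    rw [this]
    have h2 := h.periodic.intervalIntegral_add_eq y 0
    simp only [Nat.cast_zero, zero_div, add_zero, div_self hqr.ne']
    rw [h2, zero_add, h0, mul_zero]
  have hsumD : ∑ n ∈ range q, D (n * (p / q)) = 2 * V := by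
    rw [reindex hDp p q hq hc]
    have e : ∀ j : ℕ, D (j / q) = (v (y + ((j + 1 : ℕ) : ℝ) / q) - v (y + j / q)) +
        (v (y + (((j + 1 : ℕ) : ℝ) - 1) / q) - v (y + ((j:ℝ) - 1) / q)) := by
      intro j
      simp only [hD]
      rw [show y + (j:ℝ) / q + 1 / q = y + ((j + 1 : ℕ) : ℝ) / q by push_cast; ring,
        show y + (j:ℝ) / q - 1 / q = y + ((j:ℝ) - 1) / q by ring]
      push_cast; ring_nf
    simp only [e]
    rw [Finset.sum_add_distrib, Finset.sum_range_sub (fun j : ℕ => v (y + (j:ℝ) / q)),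
      Finset.sum_range_sub (fun j : ℕ => v (y + ((j:ℝ) - 1) / q))]
    have h1 := h.vper y
    have h2 := h.vper (y + (0 - 1) / q)
    rw [show y + (0 - 1) / (q:ℝ) + 1 = y + (q - 1) / q by field_simp; ring] at h2
    simp only [Nat.cast_zero, zero_div, add_zero, div_self hqr.ne']
    rw [h1, h2]; ring
  calc |∑ n ∈ range q, f (y + n * x)| = |∑ n ∈ range q, (f (y + n * x) - I (n * (p / q)))| := by
        rw [Finset.sum_sub_distrib, hsumI, sub_zero]
    _ ≤ ∑ n ∈ range q, |f (y + n * x) - I (n * (p / q))| := Finset.abs_sum_le_sum_abs _ _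
    _ ≤ ∑ n ∈ range q, D (n * (p / q)) := Finset.sum_le_sum hterm
    _ = 2 * V := hsumD

lemma block_bound (h : GoodFn f v V) (h0 : ∫ x in (0:ℝ)..1, f x = 0) (x : ℝ) (p : ℤ) (q : ℕ)
    (hq : 0 < q) (hc : IsCoprime p (q:ℤ)) (hx : |x - p / q| ≤ 1 / q ^ 2) (a r : ℕ) :
    ∀ y, ∃ y', |∑ n ∈ range (a * q + r), f (y + n * x)| ≤ 2 * V * a + |∑ n ∈ range r, f (y' + n * x)| := by
  induction a with
  | zero => intro y; exact ⟨y, by simp⟩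
  | succ a ih =>
    intro y
    obtain ⟨y', hy'⟩ := ih (y + q * x)
    refine ⟨y', ?_⟩
    rw [show (a + 1) * q + r = q + (a * q + r) by ring, Finset.sum_range_add]
    have e : ∀ n : ℕ, y + ((q + n : ℕ):ℝ) * x = y + q * x + n * x := by intro n; push_cast; ring
    simp only [e]
    have := h.denjoy_koksma h0 x y p q hq hc hx
    have h3 := abs_add_le (∑ n ∈ range q, f (y + n * x)) (∑ n ∈ range (a * q + r), f (y + q * x + n * x))
    push_cast
    linarith

/-- Differences along a rotation that is close to the identity. -/
lemma diff_sum (h : GoodFn f v V) (y α θ : ℝ) (p : ℤ) (hα : |α - p| ≤ θ) (U : ℕ) :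
    ∑ u ∈ range U, |f (y + (u + 1 : ℕ) * α) - f (y + u * α)| ≤ V * (U * θ + 1) := by
  set β := α - p with hβ
  have e : ∀ u : ℕ, f (y + u * α) = f (y + u * β) := by
    intro u
    have := h.add_int (y + u * β) (u * p)
    rw [← this]; congr 1; push_cast; rw [hβ]; ring
  simp only [e]
  have hV := h.V_nonneg
  have hc : ∀ t : ℝ, 0 ≤ t → ∀ z, v (z + t) - v z ≤ V * (t + 1) := by
    intro t ht z
    have h1 := h.mono (show z + t ≤ z + (⌈t⌉₊ : ℕ) by gcongr; exact Nat.le_ceil t)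
    rw [h.v_add_nat] at h1
    have h2 := (Nat.ceil_lt_add_one ht).le
    nlinarith
  have hU : (0:ℝ) ≤ U := Nat.cast_nonneg U
  rcases le_total 0 β with hb | hb
  · calc _ ≤ ∑ u ∈ range U, (v (y + (u + 1 : ℕ) * β) - v (y + u * β)) := by
          refine Finset.sum_le_sum fun u _ => h.dom _ _ ?_
          push_cast; nlinarith
      _ = v (y + U * β) - v y := by
          rw [Finset.sum_range_sub (fun u : ℕ => v (y + u * β))]; simp
      _ ≤ V * (U * β + 1) := hc _ (by positivity) y
      _ ≤ _ := by
          rw [abs_of_nonneg hb] at hα; gcongr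
  · calc _ ≤ ∑ u ∈ range U, -(v (y + (u + 1 : ℕ) * β) - v (y + u * β)) := by
          refine Finset.sum_le_sum fun u _ => ?_
          rw [abs_sub_comm, neg_sub]
          refine h.dom _ _ ?_
          push_cast; nlinarith
      _ = v (y + U * β + U * (-β)) - v (y + U * β) := by
          rw [Finset.sum_neg_distrib, Finset.sum_range_sub (fun u : ℕ => v (y + u * β))]; simp
      _ ≤ V * (U * (-β) + 1) := hc _ (mul_nonneg hU (by linarith)) _
      _ ≤ _ := by
          rw [abs_of_nonpos hb] at hα; gcongr

end GoodFn

/-- A Diophantine condition valid almost everywhere. -/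
def DiophR (x : ℝ) : Prop := ∃ c : ℝ, 0 < c ∧ ∀ q : ℕ, 0 < q → ∀ p : ℤ, c ≤ |q * x - p| ^ 3 * q ^ 4

lemma DiophR.two_mul {x : ℝ} (h : DiophR x) : DiophR (2 * x) := by
  obtain ⟨c, hc, H⟩ := h
  refine ⟨c / 16, by positivity, fun q hq p => ?_⟩
  have := H (2 * q) (by omega) p
  push_cast at this
  rw [show (q:ℝ) * (2 * x) = 2 * q * x by ring]
  nlinarith

lemma ae_dioph : ∀ᵐ x : ℝ, DiophR x := by
  have hirr : ∀ᵐ x : ℝ, Irrational x := by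
    have : (Set.range ((↑) : ℚ → ℝ)).Countable := Set.countable_range _
    exact (this.ae_notMem volume)
  filter_upwards [ae_not_liouvilleWith, hirr] with x hx hir
  have h := hx (7/3) (by norm_num)
  unfold LiouvilleWith at h
  push Not at h
  have h1 := h 1
  rw [eventually_atTop] at h1
  obtain ⟨n0, hn0⟩ := h1
  have hpos : ∀ q : ℕ, 0 < q → ∀ p : ℤ, 0 < |q * x - p| := by
    intro q hq p
    rw [abs_pos, sub_ne_zero]
    intro he
    have := (hir.natCast_mul (m := q) hq.ne')
    exact this.ne_int p he
  -- small q
  have hsmall : ∀ N : ℕ, ∃ c : ℝ, 0 < c ∧ ∀ q : ℕ, 0 < q → q < N → ∀ p : ℤ, c ≤ |q * x - p| ^ 3 * q ^ 4 := by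
    intro N
    induction N with
    | zero => exact ⟨1, one_pos, fun q _ hq => by omega⟩
    | succ N ih =>
      obtain ⟨c, hc, H⟩ := ih
      rcases Nat.eq_zero_or_pos N with h0 | h0
      · exact ⟨1, one_pos, fun q _ hq => by omega⟩
      have hr := hpos N h0 (round (N * x))
      have hN : (1:ℝ) ≤ N := by exact_mod_cast h0
      refine ⟨min c (|N * x - round (N * x)| ^ 3), by positivity, fun q hq hqN p => ?_⟩
      rcases Nat.lt_succ_iff_lt_or_eq.1 hqN with h1 | h1
      · exact (min_le_left _ _).trans (H q hq h1 p)
      · subst h1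
        refine (min_le_right _ _).trans ?_
        have := round_le (q * x) p
        calc |q * x - round (q * x)| ^ 3 ≤ |q * x - p| ^ 3 := by gcongr
          _ ≤ |q * x - p| ^ 3 * q ^ 4 := le_mul_of_one_le_right (by positivity) (one_le_pow₀ hN)
  obtain ⟨c, hc, H⟩ := hsmall (n0 + 1)
  refine ⟨min c 1, by positivity, fun q hq p => ?_⟩
  by_cases hqn : q < n0 + 1
  · exact (min_le_left _ _).trans (H q hq hqn p)
  · refine (min_le_right _ _).trans ?_
    have hq' : (0:ℝ) < q := by exact_mod_cast hq
    have h3 := hn0 q (by omega) p (by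
      intro he
      have := hpos q hq p
      rw [he, mul_div_cancel₀ _ hq'.ne', sub_self, abs_zero] at this
      exact lt_irrefl _ this)
    have h4 : |q * x - p| = q * |x - p / q| := by
      rw [← abs_of_pos hq', ← abs_mul, abs_of_pos hq']; congr 1; field_simp
    rw [h4]
    have h5 : ((q:ℝ) ^ (7/3:ℝ)) ^ 3 = q ^ 7 := by
      rw [← Real.rpow_natCast, ← Real.rpow_mul hq'.le, ← Real.rpow_natCast]; norm_num
    have h6 : 0 < (q:ℝ) ^ (7/3:ℝ) := by positivity
    calc (1:ℝ) = (q * (1 / q ^ (7/3:ℝ))) ^ 3 * q ^ 4 := by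
          rw [mul_pow, div_pow, h5]; field_simp
      _ ≤ _ := by gcongr



lemma DiophR.approx {x : ℝ} (h : DiophR x) : ∃ κ : ℝ, 0 < κ ∧ ∀ M : ℕ, 0 < M → ∃ (p : ℤ) (q : ℕ), 0 < q ∧
    IsCoprime p (q:ℤ) ∧ |x - p / q| ≤ 1 / q ^ 2 ∧ κ * √M ≤ q ∧ (q:ℝ) ≤ 2 * (M:ℝ) ^ (2/3:ℝ) := by
  obtain ⟨c, hc, H⟩ := h
  refine ⟨c ^ (1/4:ℝ), by positivity, fun M hM => ?_⟩
  have hM1 : (1:ℝ) ≤ M := by exact_mod_cast hM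
  have hM2 : (1:ℝ) ≤ (M:ℝ) ^ (2/3:ℝ) := Real.one_le_rpow hM1 (by norm_num)
  set Q := ⌈(M:ℝ) ^ (2/3:ℝ)⌉₊ with hQ
  have hQM : (M:ℝ) ^ (2/3:ℝ) ≤ Q := Nat.le_ceil _
  have hQM2 : (Q:ℝ) ≤ (M:ℝ) ^ (2/3:ℝ) + 1 := (Nat.ceil_lt_add_one (by positivity)).le
  have hQpos : 0 < Q := by
    have : (0:ℝ) < Q := by linarith
    exact_mod_cast this
  obtain ⟨r, hr1, hr2⟩ := Real.exists_rat_abs_sub_le_and_den_le x hQpos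
  have hd : (0:ℝ) < r.den := by exact_mod_cast r.den_pos
  have hdQ : (r.den:ℝ) ≤ Q := by exact_mod_cast hr2
  have hrr : (r:ℝ) = r.num / r.den := by exact_mod_cast (Rat.num_div_den r).symm
  rw [hrr] at hr1
  refine ⟨r.num, r.den, r.den_pos, ?_, ?_, ?_, by linarith⟩
  · exact Int.isCoprime_iff_gcd_eq_one.2 r.reduced
  · refine hr1.trans ?_
    apply one_div_le_one_div_of_le (by positivity)
    nlinarith
  · have h1 := H r.den r.den_pos r.num
    have h2 : |r.den * x - r.num| ≤ 1 / (Q + 1) := by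
      have : r.den * x - r.num = r.den * (x - r.num / r.den) := by field_simp
      rw [this, abs_mul, abs_of_pos hd]
      calc (r.den:ℝ) * |x - r.num / r.den| ≤ r.den * (1 / ((Q + 1) * r.den)) := by gcongr
        _ = 1 / (Q + 1) := by field_simp
    have h3 : c ≤ (1 / ((Q:ℝ) + 1)) ^ 3 * r.den ^ 4 := h1.trans (by gcongr)
    have h4 : c * ((Q:ℝ) + 1) ^ 3 ≤ r.den ^ 4 := by
      rw [div_pow, one_pow, one_div, inv_mul_eq_div, le_div_iff₀ (by positivity)] at h3
      exact h3
    have h5 : (M:ℝ) ^ 2 ≤ ((Q:ℝ) + 1) ^ 3 := by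
      calc (M:ℝ) ^ 2 = ((M:ℝ) ^ (2/3:ℝ)) ^ 3 := by
            rw [← Real.rpow_natCast, ← Real.rpow_natCast, ← Real.rpow_mul (by positivity)]; norm_num
        _ ≤ _ := by gcongr; linarith
    have h6 : (c ^ (1/4:ℝ) * √M) ^ 4 ≤ (r.den:ℝ) ^ 4 := by
      rw [mul_pow]
      have e1 : (c ^ (1/4:ℝ)) ^ 4 = c := by
        rw [← Real.rpow_natCast, ← Real.rpow_mul hc.le]; norm_num
      have e2 : (√(M:ℝ)) ^ 4 = M ^ 2 := by
        rw [show 4 = 2 * 2 by norm_num, pow_mul, Real.sq_sqrt (by positivity)]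
      rw [e1, e2]
      exact le_trans (by gcongr) h4
    exact (pow_le_pow_iff_left₀ (by positivity) hd.le (by norm_num)).1 h6

lemma GoodFn.sqrt_bound {f v : ℝ → ℝ} {V : ℝ} (h : GoodFn f v V) (h0 : ∫ x in (0:ℝ)..1, f x = 0)
    {x : ℝ} (hx : DiophR x) :
    ∃ C : ℝ, 0 ≤ C ∧ ∀ (M : ℕ) (y : ℝ), |∑ n ∈ range M, f (y + n * x)| ≤ C * √M := by
  obtain ⟨κ, hκ, H⟩ := hx.approx
  have hV := h.V_nonneg
  set B := |f 0| + V with hB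
  have hB0 : 0 ≤ B := by positivity
  have hsum : ∀ (r : ℕ) (y : ℝ), |∑ n ∈ range r, f (y + n * x)| ≤ B * r := by
    intro r y
    calc _ ≤ ∑ n ∈ range r, |f (y + n * x)| := Finset.abs_sum_le_sum_abs _ _
      _ ≤ ∑ n ∈ range r, B := Finset.sum_le_sum fun n _ => h.bdd _
      _ = B * r := by simp [mul_comm]
  have hdecomp : ∀ M : ℕ, 0 < M → ∀ y, ∃ r : ℕ, (r:ℝ) ≤ 2 * (M:ℝ) ^ (2/3:ℝ) ∧ ∃ y',
      |∑ n ∈ range M, f (y + n * x)| ≤ 2 * V / κ * √M + |∑ n ∈ range r, f (y' + n * x)| := by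
    intro M hM y
    obtain ⟨p, q, hq, hc, hpq, h1, h2⟩ := H M hM
    have hq' : (0:ℝ) < q := by exact_mod_cast hq
    obtain ⟨y', hy'⟩ := h.block_bound h0 x p q hq hc hpq (M / q) (M % q) y
    rw [Nat.div_add_mod'] at hy'
    refine ⟨M % q, ?_, y', hy'.trans ?_⟩
    · have : ((M % q : ℕ):ℝ) ≤ q := by exact_mod_cast (Nat.mod_lt M hq).le
      linarith
    · have h3 : ((M / q : ℕ):ℝ) ≤ M / q := Nat.cast_div_le
      have h4 : (M:ℝ) / q ≤ √M / κ := by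
        rw [div_le_div_iff₀ hq' hκ]
        have : (√(M:ℝ)) * √M = M := Real.mul_self_sqrt (by positivity)
        nlinarith [Real.sqrt_nonneg (M:ℝ)]
      have : 2 * V * ((M / q : ℕ):ℝ) ≤ 2 * V * (√M / κ) := by gcongr; linarith
      have e : 2 * V * (√M / κ) = 2 * V / κ * √M := by ring
      linarith
  have hpow : ∀ M : ℕ, 0 < M → √(M:ℝ) ≤ (M:ℝ) ^ (2/3:ℝ) := by
    intro M hM
    rw [Real.sqrt_eq_rpow]
    exact Real.rpow_le_rpow_of_exponent_le (by exact_mod_cast hM) (by norm_num)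
  have hweak : ∀ (M : ℕ) (y : ℝ), |∑ n ∈ range M, f (y + n * x)| ≤ (2 * V / κ + 2 * B) * (M:ℝ) ^ (2/3:ℝ) := by
    intro M y
    rcases Nat.eq_zero_or_pos M with hM | hM
    · subst hM; simp
    obtain ⟨r, hr, y', hy'⟩ := hdecomp M hM y
    have h1 := hsum r y'
    have h2 := hpow M hM
    have h3 : B * r ≤ B * (2 * (M:ℝ) ^ (2/3:ℝ)) := by gcongr
    have h4 : 2 * V / κ * √M ≤ 2 * V / κ * (M:ℝ) ^ (2/3:ℝ) := by gcongr
    nlinarith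
  refine ⟨2 * V / κ + (2 * V / κ + 2 * B) * 2, by positivity, fun M y => ?_⟩
  rcases Nat.eq_zero_or_pos M with hM | hM
  · subst hM; simp
  obtain ⟨r, hr, y', hy'⟩ := hdecomp M hM y
  have h1 := hweak r y'
  have hM1 : (1:ℝ) ≤ M := by exact_mod_cast hM
  have h2 : (r:ℝ) ^ (2/3:ℝ) ≤ 2 * √M := by
    calc (r:ℝ) ^ (2/3:ℝ) ≤ (2 * (M:ℝ) ^ (2/3:ℝ)) ^ (2/3:ℝ) := by gcongr
      _ = 2 ^ (2/3:ℝ) * (M:ℝ) ^ (4/9:ℝ) := by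
        rw [Real.mul_rpow (by norm_num) (by positivity), ← Real.rpow_mul (by positivity)]; norm_num
      _ ≤ 2 ^ (1:ℝ) * (M:ℝ) ^ (1/2:ℝ) := by
        exact mul_le_mul (Real.rpow_le_rpow_of_exponent_le (by norm_num) (by norm_num))
          (Real.rpow_le_rpow_of_exponent_le hM1 (by norm_num)) (by positivity) (by positivity)
      _ = 2 * √M := by rw [Real.rpow_one, Real.sqrt_eq_rpow]
  have h3 : (2 * V / κ + 2 * B) * (r:ℝ) ^ (2/3:ℝ) ≤ (2 * V / κ + 2 * B) * (2 * √M) := by gcongr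
  linarith



/-- The sign of a coin. -/
noncomputable def sg (b : Bool) : ℝ := if b then 1 else -1

/-- Partial Rademacher sums. -/
noncomputable def RS {K : ℕ} (a : ℕ → ℝ) (e : Fin K → Bool) (i : ℕ) : ℝ :=
  ∑ j : Fin K, if (j:ℕ) < i then sg (e j) * a j else 0

lemma RS_zero {K : ℕ} (a : ℕ → ℝ) (e : Fin K → Bool) : RS a e 0 = 0 := by simp [RS]

lemma RS_cons {K : ℕ} (a : ℕ → ℝ) (b : Bool) (e : Fin K → Bool) (i : ℕ) :
    RS a (Fin.cons b e : Fin (K+1) → Bool) (i+1) = sg b * a 0 + RS (fun j => a (j+1)) e i := by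
  simp [RS, Fin.sum_univ_succ]

lemma RS_full {K : ℕ} (a : ℕ → ℝ) (e : Fin K → Bool) : RS a e K = ∑ j : Fin K, sg (e j) * a j := by
  simp [RS]

lemma sum_cons_bool {K : ℕ} (g : (Fin (K+1) → Bool) → ℝ) :
    ∑ e, g e = ∑ e : Fin K → Bool, g (Fin.cons true e) + ∑ e : Fin K → Bool, g (Fin.cons false e) := by
  rw [← (Fin.consEquiv (fun _ : Fin (K+1) => Bool)).sum_comp, Fintype.sum_prod_type, Fintype.sum_bool]
  rfl

lemma RS_mgf (K : ℕ) (a : ℕ → ℝ) (l : ℝ) :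
    ∑ e : Fin K → Bool, exp (l * RS a e K) = 2 ^ K * ∏ j ∈ range K, cosh (l * a j) := by
  induction K generalizing a with
  | zero => simp [RS]
  | succ K ih =>
    rw [sum_cons_bool]
    simp only [RS_cons, mul_add, exp_add, ← Finset.mul_sum, ih]
    rw [Finset.prod_range_succ', Real.cosh_eq]
    simp only [sg]
    simp only [if_true, Bool.false_eq_true, if_false, one_mul, neg_mul, mul_neg]
    ring

lemma RS_max (K : ℕ) (a : ℕ → ℝ) (t l : ℝ) (hl : 0 ≤ l) :
    ∑ e : Fin K → Bool, (if ∃ i ≤ K, t ≤ RS a e i then (1:ℝ) else 0) ≤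
      2 ^ K * (exp (-(l*t)) * ∏ j ∈ range K, cosh (l * a j)) := by
  classical
  induction K generalizing a t with
  | zero =>
    simp [RS]
    split_ifs with h
    · apply Real.one_le_exp; nlinarith
    · positivity
  | succ K ih =>
    have hP : ∀ (K : ℕ) (a : ℕ → ℝ), 1 ≤ ∏ j ∈ range K, cosh (l * a j) := fun K a => by
      induction K with
      | zero => simp
      | succ K ih2 =>
        rw [Finset.prod_range_succ]
        exact one_le_mul_of_one_le_of_one_le ih2 (Real.one_le_cosh _)
    by_cases ht : t ≤ 0
    · calc _ ≤ ∑ e : Fin (K+1) → Bool, (1:ℝ) := by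
            apply Finset.sum_le_sum; intro e _; split_ifs <;> norm_num
        _ = 2 ^ (K+1) * (1 * 1) := by simp
        _ ≤ _ := by
            have h1 : 1 ≤ exp (-(l*t)) := by apply Real.one_le_exp; nlinarith
            have := hP (K+1) a
            gcongr
    · push Not at ht
      rw [sum_cons_bool]
      have key : ∀ b : Bool, ∑ e : Fin K → Bool,
          (if ∃ i ≤ K+1, t ≤ RS a (Fin.cons b e : Fin (K+1) → Bool) i then (1:ℝ) else 0) ≤
          2 ^ K * (exp (-(l*(t - sg b * a 0))) * ∏ j ∈ range K, cosh (l * a (j+1))) := by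
        intro b
        refine le_trans (Finset.sum_le_sum ?_) (ih (fun j => a (j+1)) (t - sg b * a 0))
        intro e _
        by_cases h : ∃ i ≤ K+1, t ≤ RS a (Fin.cons b e : Fin (K+1) → Bool) i
        · obtain ⟨i, hi, hti⟩ := h
          rcases i with _ | i
          · rw [RS_zero] at hti; linarith
          · rw [RS_cons] at hti
            rw [if_pos (⟨i, by omega, by linarith⟩ : ∃ i ≤ K, _)]
            split_ifs <;> norm_num
        · rw [if_neg h]; split_ifs <;> norm_num
      refine (add_le_add (key true) (key false)).trans (le_of_eq ?_)
      rw [Finset.prod_range_succ', Real.cosh_eq]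
      simp only [sg, if_true, Bool.false_eq_true, if_false, one_mul, neg_mul, sub_neg_eq_add]
      rw [show -(l * (t - a 0)) = -(l*t) + l * a 0 by ring, show -(l * (t + a 0)) = -(l*t) + -(l * a 0) by ring,
        exp_add, exp_add]
      ring

lemma prod_cosh_le (K : ℕ) (a : ℕ → ℝ) (l : ℝ) :
    ∏ j ∈ range K, cosh (l * a j) ≤ exp (l^2 * (∑ j ∈ range K, a j ^ 2) / 2) := by
  calc _ ≤ ∏ j ∈ range K, exp ((l * a j)^2/2) := by
        apply Finset.prod_le_prod
        · intro i _; exact (Real.cosh_pos _).le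
        · intro i _; exact Real.cosh_le_exp_half_sq _
    _ = _ := by
      rw [← Real.exp_sum]; congr 1
      rw [Finset.mul_sum, Finset.sum_div]; apply Finset.sum_congr rfl; intros; ring

lemma RS_neg {K : ℕ} (a : ℕ → ℝ) (e : Fin K → Bool) (i : ℕ) : RS (fun j => - a j) e i = - RS a e i := by
  simp only [RS, ← Finset.sum_neg_distrib]
  apply Finset.sum_congr rfl; intro j _; split_ifs <;> simp

lemma RS_maxabs (K : ℕ) (a : ℕ → ℝ) (t v : ℝ) (ht : 0 ≤ t) (hv : 0 < v)
    (hav : ∑ j ∈ range K, a j ^ 2 ≤ v) :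
    ∑ e : Fin K → Bool, (if ∃ i ≤ K, t ≤ |RS a e i| then (1:ℝ) else 0) ≤
      2 * 2 ^ K * exp (-(t^2/(2*v))) := by
  classical
  have h : ∀ a : ℕ → ℝ, ∑ j ∈ range K, a j ^ 2 ≤ v →
      ∑ e : Fin K → Bool, (if ∃ i ≤ K, t ≤ RS a e i then (1:ℝ) else 0) ≤ 2 ^ K * exp (-(t^2/(2*v))) := by
    intro a hav
    refine (RS_max K a t (t/v) (by positivity)).trans ?_
    gcongr
    refine (mul_le_mul_of_nonneg_left (prod_cosh_le K a (t/v)) (by positivity)).trans ?_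
    rw [← exp_add]; apply Real.exp_le_exp.mpr
    have : (t/v)^2 * (∑ j ∈ range K, a j ^ 2) / 2 ≤ (t/v)^2 * v / 2 := by gcongr
    have h2 : -(t/v*t) + (t/v)^2 * v/2 = -(t^2/(2*v)) := by field_simp; ring
    linarith
  have h1 := h a hav
  have h2 := h (fun j => - a j) (by simpa using hav)
  have : ∑ e : Fin K → Bool, (if ∃ i ≤ K, t ≤ |RS a e i| then (1:ℝ) else 0) ≤
      ∑ e : Fin K → Bool, (if ∃ i ≤ K, t ≤ RS a e i then (1:ℝ) else 0) +
      ∑ e : Fin K → Bool, (if ∃ i ≤ K, t ≤ RS (fun j => - a j) e i then (1:ℝ) else 0) := by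
    rw [← Finset.sum_add_distrib]
    apply Finset.sum_le_sum
    intro e _
    by_cases hh : ∃ i ≤ K, t ≤ |RS a e i|
    · rw [if_pos hh]
      obtain ⟨i, hi, hti⟩ := hh
      rcases le_abs.mp hti with h | h
      · rw [if_pos ⟨i, hi, h⟩]; split_ifs <;> norm_num
      · have h' : ∃ i ≤ K, t ≤ RS (fun j => - a j) e i := ⟨i, hi, by rw [RS_neg]; exact h⟩
        rw [if_pos h']; split_ifs <;> norm_num
    · rw [if_neg hh]; split_ifs <;> norm_num
  linarith

lemma exp_le_cosh (u : ℝ) : exp (u^2/2 - u^4/8) ≤ cosh u := by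
  have h1 : 1 + u^2/2 ≤ cosh u := by
    have e1 : cosh u = 1 + 2 * sinh (u/2)^2 := by
      have := Real.cosh_two_mul (u/2)
      have h2 := Real.cosh_sq (u/2)
      rw [show 2*(u/2) = u by ring] at this
      linarith
    have e2 : (u/2)^2 ≤ sinh (u/2)^2 := by
      rcases le_total 0 (u/2) with h | h
      · have := Real.self_le_sinh_iff.mpr h
        nlinarith
      · have := Real.sinh_le_self_iff.mpr h
        nlinarith
    rw [e1]; nlinarith
  refine le_trans ?_ h1
  have hz : 0 ≤ u^2/2 := by positivity
  have : u^2/2 - (u^2/2)^2/2 ≤ log (1 + u^2/2) := by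
    refine le_trans ?_ (Real.le_log_one_add_of_nonneg hz)
    rw [le_div_iff₀ (by positivity)]
    have : 0 ≤ (u^2/2)^3 := by positivity
    nlinarith
  rw [← Real.le_log_iff_exp_le (by positivity)]
  nlinarith

lemma RS_lower (K : ℕ) (a : ℕ → ℝ) (τ H v : ℝ) (h0 : 0 < τ) (h1 : τ < 1) (hv : 0 < v)
    (hav : ∑ j ∈ range K, a j ^ 2 = v) (hH : log 4 ≤ H * τ^2/8)
    (ha : ∀ j < K, a j ^ 2 * H ≤ v * τ^2/4) :
    exp (-H) * 2 ^ K ≤ ∑ e : Fin K → Bool, (if (1-τ) * √(2*v*H) ≤ RS a e K then (1:ℝ) else 0) := by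
  have hl4 : 0 < log 4 := Real.log_pos (by norm_num)
  have hHp : 0 < H := by
    by_contra h; push Not at h
    nlinarith [sq_nonneg τ]
  set r := √(2*H/v) with hr
  have hr2 : r^2 = 2*H/v := Real.sq_sqrt (by positivity)
  have hrb : √(2*v*H) = r * v := by
    rw [hr, ← Real.sqrt_sq hv.le, ← Real.sqrt_mul (by positivity)]
    congr 1; rw [Real.sqrt_sq hv.le]; field_simp
  have hrp : 0 < r := Real.sqrt_pos.mpr (by positivity)
  have hrv : r^2*v = 2*H := by rw [hr2]; field_simp
  rw [hrb]
  set μ := 1 - τ/2 with hμ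
  set φ := ∏ j ∈ range K, cosh (μ*r * a j) with hφ
  have hφl : exp (H*(1-τ) + H*τ^2/8) ≤ φ := by
    have e1 : ∏ j ∈ range K, exp ((μ*r*a j)^2/2 * (1-τ^2/8)) ≤ φ := by
      apply Finset.prod_le_prod
      · intros; positivity
      · intro j hj
        refine le_trans (Real.exp_le_exp.mpr ?_) (exp_le_cosh _)
        have : (r * a j)^2 ≤ τ^2/2 := by
          rw [mul_pow, hr2]
          have := ha j (Finset.mem_range.mp hj)
          rw [div_mul_eq_mul_div, div_le_iff₀ hv]; linarith
        have hm : μ^2 ≤ 1 := by rw [hμ]; nlinarith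
        have h3 : (μ*r*a j)^2 ≤ τ^2/2 := by
          rw [mul_assoc, mul_pow]
          nlinarith [sq_nonneg (r*a j), sq_nonneg μ]
        nlinarith [sq_nonneg (μ*r*a j)]
    refine le_trans ?_ e1
    rw [← Real.exp_sum]
    apply Real.exp_le_exp.mpr
    have : ∑ j ∈ range K, (μ*r*a j)^2/2 * (1-τ^2/8) = μ^2*r^2*v/2*(1-τ^2/8) := by
      rw [← hav, Finset.mul_sum, Finset.sum_div, Finset.sum_mul]
      apply Finset.sum_congr rfl; intros; ring
    rw [this, mul_assoc (μ^2), hrv]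
    have : 0 ≤ τ^3*(1-τ/4) := by
      have : 0 ≤ 1 - τ/4 := by linarith
      positivity
    have h5 : μ^2*(2*H)/2*(1-τ^2/8) - (H*(1-τ)+H*τ^2/8) = H * (τ^3*(1-τ/4))/8 := by
      rw [hμ]; ring
    have : 0 ≤ H * (τ^3*(1-τ/4))/8 := by positivity
    linarith
  have hφ4 : exp (H*(1-τ)) ≤ φ/4 := by
    have : exp (H*(1-τ)) * 4 ≤ exp (H*(1-τ) + H*τ^2/8) := by
      rw [exp_add]; gcongr
      rw [← Real.exp_log (show (0:ℝ) < 4 by norm_num)]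
      exact Real.exp_le_exp.mpr hH
    linarith
  have hmg : ∀ l, ∑ e : Fin K → Bool, exp (l * RS a e K) ≤ 2^K * exp (l^2*v/2) := by
    intro l; rw [RS_mgf]; gcongr
    rw [← hav]; exact prod_cosh_le K a l
  have hpt : ∀ S : ℝ, exp (μ*r*S) ≤ (if (1-τ)*(r*v) ≤ S then 1 else 0) * exp (μ*r*(r*v))
      + exp (-(τ/2*r)*(r*v)) * exp (r*S) + exp (τ/2*r*((1-τ)*(r*v))) * exp ((1-τ)*r*S) := by
    intro S
    rw [← exp_add, ← exp_add]
    have q1 := exp_pos (-(τ/2*r)*(r*v) + r*S)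
    have q2 := exp_pos (τ/2*r*((1-τ)*(r*v)) + (1-τ)*r*S)
    split_ifs with hS
    · by_cases hS2 : S ≤ r*v
      · have : exp (μ*r*S) ≤ exp (μ*r*(r*v)) := by
          apply Real.exp_le_exp.mpr
          have : 0 ≤ μ * r := mul_nonneg (by rw [hμ]; linarith) hrp.le
          nlinarith
        linarith
      · push Not at hS2
        have : exp (μ*r*S) ≤ exp (-(τ/2*r)*(r*v) + r*S) := by
          apply Real.exp_le_exp.mpr
          have : 0 ≤ τ/2*r*(S - r*v) := by
            have : 0 ≤ S - r*v := by linarith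
            positivity
          rw [hμ]; nlinarith
        have q3 := exp_pos (μ*r*(r*v))
        linarith
    · push Not at hS
      have : exp (μ*r*S) ≤ exp (τ/2*r*((1-τ)*(r*v)) + (1-τ)*r*S) := by
        apply Real.exp_le_exp.mpr
        have : 0 ≤ τ/2*r*((1-τ)*(r*v) - S) := by
          have : 0 ≤ (1-τ)*(r*v) - S := by linarith
          positivity
        rw [hμ]; nlinarith
      linarith
  set P := ∑ e : Fin K → Bool, (if (1-τ) * (r*v) ≤ RS a e K then (1:ℝ) else 0) with hP
  have hsum : 2^K * φ ≤ P * exp (μ*r*(r*v)) + 2^K * exp (H*(1-τ)) + 2^K * exp (H*(1-τ)) := by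
    rw [hφ, ← RS_mgf]
    refine (Finset.sum_le_sum (fun e _ => hpt (RS a e K))).trans ?_
    rw [Finset.sum_add_distrib, Finset.sum_add_distrib, ← Finset.sum_mul, ← Finset.mul_sum, ← Finset.mul_sum]
    have e1 := mul_le_mul_of_nonneg_left (hmg r) (exp_pos (-(τ/2*r)*(r*v))).le
    have e2 := mul_le_mul_of_nonneg_left (hmg ((1-τ)*r)) (exp_pos (τ/2*r*((1-τ)*(r*v)))).le
    have e3 : exp (-(τ/2*r)*(r*v)) * (2^K * exp (r^2*v/2)) = 2^K * exp (H*(1-τ)) := by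
      rw [mul_left_comm, ← exp_add]; congr 2
      rw [show -(τ/2*r)*(r*v) + r^2*v/2 = (1-τ) * (r^2*v)/2 by ring, hrv]; ring
    have e4 : exp (τ/2*r*((1-τ)*(r*v))) * (2^K * exp (((1-τ)*r)^2*v/2)) = 2^K * exp (H*(1-τ)) := by
      rw [mul_left_comm, ← exp_add]; congr 2
      rw [show τ/2*r*((1-τ)*(r*v)) + ((1-τ)*r)^2*v/2 = (1-τ) * (r^2*v)/2 by ring, hrv]; ring
    rw [e3] at e1; rw [e4] at e2
    linarith
  have hK : (0:ℝ) < 2^K := by positivity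
  have h7 : 2^K * (φ/2) ≤ P * exp (μ*r*(r*v)) := by nlinarith
  have h8 : exp (-H) * exp (μ*r*(r*v)) ≤ φ/2 := by
    rw [← exp_add, show μ*r*(r*v) = μ * (r^2*v) by ring, hrv]
    rw [show -H + μ * (2*H) = H*(1-τ) by rw [hμ]; ring]
    have := exp_pos (H*(1-τ))
    linarith
  have h9 := exp_pos (μ*r*(r*v))
  have : exp (-H) * 2^K * exp (μ*r*(r*v)) ≤ P * exp (μ*r*(r*v)) := by nlinarith
  exact le_of_mul_le_mul_right this h9



lemma sum_range_mul_block (q L : ℕ) (F : ℕ → ℝ) :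
    ∑ o ∈ range (q*L), F o = ∑ l ∈ range L, ∑ r ∈ range q, F (q*l+r) := by
  induction L with
  | zero => simp
  | succ L ih => rw [Nat.mul_succ, Finset.sum_range_add, ih, Finset.sum_range_succ]

/-- Run sums. -/
noncomputable def blk (q L : ℕ) (g : ℕ → ℝ) (i : ℕ) : ℝ :=
  ∑ l ∈ range L, g ((i/q)*(q*L) + l*q + i%q)

/-- Index of the run containing an offset. -/
def ridx (q L o : ℕ) : ℕ := (o/(q*L))*q + o%q

lemma sum_runs (q L : ℕ) (hq : 0 < q) (F : ℕ → ℕ → ℝ) (j : ℕ) :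
    ∑ i ∈ range (q*j), ∑ l ∈ range L, F i ((i/q)*(q*L) + l*q + i%q)
      = ∑ k ∈ range j, ∑ r ∈ range q, ∑ l ∈ range L, F (q*k+r) (k*(q*L) + l*q + r) := by
  rw [sum_range_mul_block]
  apply Finset.sum_congr rfl; intro k _
  apply Finset.sum_congr rfl; intro r hr
  have hr := Finset.mem_range.mp hr
  have e1 : (q*k+r)/q = k := by rw [Nat.mul_add_div hq, Nat.div_eq_of_lt hr, add_zero]
  have e2 : (q*k+r)%q = r := by rw [Nat.mul_add_mod, Nat.mod_eq_of_lt hr]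
  rw [e1, e2]

lemma sum_reorg (q L : ℕ) (hq : 0 < q) (hL : 0 < L) (g c : ℕ → ℝ) (j : ℕ) :
    ∑ o ∈ range (q*L*j), c (ridx q L o) * g o = ∑ i ∈ range (q*j), c i * blk q L g i := by
  simp only [blk, Finset.mul_sum]
  rw [sum_runs q L hq (fun i o => c i * g o), sum_range_mul_block]
  apply Finset.sum_congr rfl; intro k _
  rw [sum_range_mul_block, Finset.sum_comm]
  apply Finset.sum_congr rfl; intro r hr
  apply Finset.sum_congr rfl; intro l hl
  have hr := Finset.mem_range.mp hr
  have hl := Finset.mem_range.mp hl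
  have h1 : q*l+r < q*L := by
    calc q*l+r < q*l+q := by omega
      _ = q*(l+1) := by ring
      _ ≤ q*L := Nat.mul_le_mul_left _ hl
  have e1 : (q*L*k+(q*l+r))/(q*L) = k := by
    rw [Nat.mul_add_div (Nat.mul_pos hq hL), Nat.div_eq_of_lt h1, add_zero]
  have e2 : (q*L*k+(q*l+r))%q = r := by
    rw [show q*L*k+(q*l+r) = q*(L*k+l)+r by ring, Nat.mul_add_mod, Nat.mod_eq_of_lt hr]
  rw [ridx, e1, e2]
  congr 2 <;> ring

lemma sum_blk_sq_le (q L : ℕ) (hq : 0 < q) (hL : 0 < L) (g : ℕ → ℝ) (j : ℕ) :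
    ∑ i ∈ range (q*j), blk q L g i ^ 2 ≤ L * ∑ o ∈ range (q*L*j), g o ^ 2 := by
  have h := sum_reorg q L hq hL (fun o => g o ^ 2) (fun _ => 1) j
  simp only [one_mul] at h
  rw [h, Finset.mul_sum]
  apply Finset.sum_le_sum; intro i _
  have := sq_sum_le_card_mul_sum_sq (s := range L) (f := fun l => g ((i/q)*(q*L) + l*q + i%q))
  simpa [blk] using this

lemma sq_sum_lower (L : ℕ) (g : ℕ → ℝ) (B : ℝ) (hB : ∀ l, |g l| ≤ B) :
    L * ∑ l ∈ range L, g l ^ 2 - L^2 * B * ∑ l ∈ range L, |g (l+1) - g l| ≤ (∑ l ∈ range L, g l)^2 := by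
  set D := ∑ l ∈ range L, |g (l+1) - g l| with hD
  have hd : ∀ l < L, ∀ m < L, l ≤ m → |g m - g l| ≤ D := by
    intro l hl m hm hlm
    have h1 : g m - g l = ∑ k ∈ Finset.Ico l m, (g (k+1) - g k) := by
      rw [Finset.sum_Ico_eq_sub _ hlm, Finset.sum_range_sub, Finset.sum_range_sub]; ring
    rw [h1]
    refine (Finset.abs_sum_le_sum_abs _ _).trans ?_
    apply Finset.sum_le_sum_of_subset_of_nonneg
    · intro k hk; simp at hk ⊢; omega
    · intros; positivity
  have hd2 : ∀ l < L, ∀ m < L, (g l - g m)^2 ≤ 2*B*D := by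
    intro l hl m hm
    have h1 : |g l - g m| ≤ D := by
      rcases le_total l m with h | h
      · rw [abs_sub_comm]; exact hd l hl m hm h
      · exact hd m hm l hl h
    have h2 : |g l - g m| ≤ 2*B := by
      have := abs_sub (g l) (g m)
      linarith [hB l, hB m]
    rw [← sq_abs]
    nlinarith [abs_nonneg (g l - g m)]
  have hs : ∑ l ∈ range L, ∑ m ∈ range L, (g l - g m)^2 ≤ L^2*(2*B*D) := by
    calc _ ≤ ∑ l ∈ range L, ∑ m ∈ range L, 2*B*D := by
          apply Finset.sum_le_sum; intro l hl
          apply Finset.sum_le_sum; intro m hm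
          exact hd2 l (Finset.mem_range.mp hl) m (Finset.mem_range.mp hm)
      _ = _ := by simp; ring
  have he : ∑ l ∈ range L, ∑ m ∈ range L, (g l - g m)^2 =
      2 * (L * ∑ l ∈ range L, g l ^ 2) - 2 * (∑ l ∈ range L, g l)^2 := by
    have : ∀ l m, (g l - g m)^2 = g l ^2 + g m^2 - 2 * (g l * g m) := by intros; ring
    simp only [this, Finset.sum_sub_distrib, Finset.sum_add_distrib, ← Finset.mul_sum, ← Finset.sum_mul]
    simp [← Finset.mul_sum]
    ring
  linarith

lemma sum_blk_sq_ge (q L : ℕ) (hq : 0 < q) (hL : 0 < L) (g : ℕ → ℝ) (B : ℝ) (hB : ∀ l, |g l| ≤ B) (j : ℕ) :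
    L * ∑ o ∈ range (q*L*j), g o ^ 2 - L^2 * B * ∑ o ∈ range (q*L*j), |g (o+q) - g o| ≤
    ∑ i ∈ range (q*j), blk q L g i ^ 2 := by
  have h := sum_reorg q L hq hL (fun o => g o ^ 2) (fun _ => 1) j
  have h' := sum_reorg q L hq hL (fun o => |g (o+q) - g o|) (fun _ => 1) j
  simp only [one_mul] at h h'
  rw [h, h', Finset.mul_sum, Finset.mul_sum, ← Finset.sum_sub_distrib]
  apply Finset.sum_le_sum; intro i _
  have := sq_sum_lower L (fun l => g ((i/q)*(q*L) + l*q + i%q)) B (fun l => hB _)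
  refine le_trans (le_of_eq ?_) this
  simp only [blk]
  congr 3; funext l
  congr 3; ring

lemma blk_abs_le (q L : ℕ) (g : ℕ → ℝ) (B : ℝ) (hB : ∀ l, |g l| ≤ B) (i : ℕ) : |blk q L g i| ≤ L * B := by
  refine (Finset.abs_sum_le_sum_abs _ _).trans ?_
  refine (Finset.sum_le_sum (fun l _ => hB _)).trans ?_
  simp

lemma sum_partial (q L : ℕ) (hq : 0 < q) (hL : 0 < L) (g c : ℕ → ℝ) (B : ℝ) (hB : ∀ l, |g l| ≤ B)
    (hc : ∀ l, |c l| ≤ 1) (o : ℕ) :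
    |∑ o' ∈ range o, c (ridx q L o') * g o' - ∑ i ∈ range (q*(o/(q*L))), c i * blk q L g i| ≤ q*L*B := by
  rw [← sum_reorg q L hq hL]
  conv_lhs => rw [← Nat.div_add_mod o (q*L)]
  rw [Finset.sum_range_add]
  have e1 : (q * L * (o / (q * L)) + o % (q * L)) / (q*L) = o/(q*L) := by rw [Nat.div_add_mod]
  rw [e1, add_sub_cancel_left]
  refine (Finset.abs_sum_le_sum_abs _ _).trans ?_
  have hB0 : 0 ≤ B := (abs_nonneg _).trans (hB 0)
  refine (Finset.sum_le_sum (g := fun _ => B) (fun l _ => ?_)).trans ?_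
  · rw [abs_mul]
    have := mul_le_mul (hc (ridx q L (q * L * (o / (q * L)) + l))) (hB (q * L * (o / (q * L)) + l)) (abs_nonneg _) zero_le_one
    linarith
  · simp only [Finset.sum_const, Finset.card_range, nsmul_eq_mul]
    have : ((o % (q*L) : ℕ):ℝ) ≤ ((q*L:ℕ):ℝ) := by exact_mod_cast (Nat.mod_lt _ (Nat.mul_pos hq hL)).le
    push_cast at this
    gcongr

lemma RS_eq_sum {K : ℕ} (a : ℕ → ℝ) (e : Fin K → Bool) (i : ℕ) (hi : i ≤ K) (c : ℕ → ℝ)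
    (hc : ∀ j : Fin K, c j = sg (e j)) : RS a e i = ∑ j ∈ range i, c j * a j := by
  have : RS a e i = ∑ j : Fin K, (fun j : ℕ => if j < i then c j * a j else 0) j := by
    simp only [RS, hc]
  rw [this, Fin.sum_univ_eq_sum_range (fun j : ℕ => if j < i then c j * a j else 0) K, ← Finset.sum_filter]
  apply Finset.sum_congr _ (fun _ _ => rfl)
  ext j; simp; omega

/-! Parameters -/
/-- Window positions. -/
def Ws (s : ℕ) : ℕ := 2 * 4^(s^2)
/-- Base run length. -/
noncomputable def L0 (Λ : ℝ) : ℕ := ⌈8*Λ^2⌉₊ + 1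
/-- Type, first part. -/
def qs (s : ℕ) : ℕ := (Nat.unpair (padicValNat 2 s)).1 + 1
/-- Type, second part. -/
noncomputable def Ls (Λ : ℝ) (s : ℕ) : ℕ := (Nat.unpair (padicValNat 2 s)).2 + L0 Λ
/-- Number of cycles. -/
noncomputable def Js (Λ : ℝ) (s : ℕ) : ℕ := ⌊4*Λ^2*(2*Ws s)/(qs s * (Ls Λ s)^2 : ℝ)⌋₊
/-- Number of runs. -/
noncomputable def Ks (Λ : ℝ) (s : ℕ) : ℕ := qs s * Js Λ s
/-- Number of offsets. -/
noncomputable def Os (Λ : ℝ) (s : ℕ) : ℕ := qs s * Ls Λ s * Js Λ s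
/-- Scale. -/
noncomputable def Gs (s : ℕ) : ℝ := √(2 * (2*Ws s) * log s)

lemma qs_pos (s) : 0 < qs s := by simp [qs]
lemma Ls_pos (Λ s) : 0 < Ls Λ s := by simp [Ls, L0]
lemma Ls_ge (Λ : ℝ) (s) : 8*Λ^2 ≤ Ls Λ s := by
  have := Nat.le_ceil (8*Λ^2)
  simp only [Ls, L0]; push_cast
  have : (0:ℝ) ≤ ((Nat.unpair (padicValNat 2 s)).2:ℝ) := by positivity
  linarith
lemma padic_le (s : ℕ) : padicValNat 2 s ≤ s := by
  rcases Nat.eq_zero_or_pos s with h | h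
  · simp [h]
  · have h1 := Nat.le_of_dvd h (pow_padicValNat_dvd (p := 2) (n := s))
    exact (Nat.lt_two_pow_self.le).trans h1
lemma qs_le (s) : qs s ≤ s + 1 := by
  have := Nat.unpair_left_le (padicValNat 2 s)
  have := padic_le s
  simp only [qs]; omega
lemma Ls_le (Λ s) : Ls Λ s ≤ s + L0 Λ := by
  have := Nat.unpair_right_le (padicValNat 2 s)
  have := padic_le s
  simp only [Ls]; omega
lemma Ws_pos (s) : 0 < Ws s := by simp [Ws]
lemma OsL_le (Λ : ℝ) (s) : (Os Λ s : ℝ) * Ls Λ s ≤ 4*Λ^2*(2*Ws s) := by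
  have hq : (0:ℝ) < qs s := by exact_mod_cast qs_pos s
  have hL : (0:ℝ) < Ls Λ s := by exact_mod_cast Ls_pos Λ s
  have : (Js Λ s : ℝ) ≤ 4*Λ^2*(2*Ws s)/(qs s * (Ls Λ s)^2 : ℝ) := Nat.floor_le (by positivity)
  rw [le_div_iff₀ (by positivity)] at this
  simp only [Os]; push_cast; linarith
lemma OsL_ge (Λ : ℝ) (s) : 4*Λ^2*(2*Ws s) - qs s * (Ls Λ s:ℝ)^2 ≤ (Os Λ s : ℝ) * Ls Λ s := by
  have hq : (0:ℝ) < qs s := by exact_mod_cast qs_pos s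
  have hL : (0:ℝ) < Ls Λ s := by exact_mod_cast Ls_pos Λ s
  have : 4*Λ^2*(2*Ws s)/(qs s * (Ls Λ s)^2 : ℝ) < (Js Λ s : ℝ) + 1 := Nat.lt_floor_add_one _
  rw [div_lt_iff₀ (by positivity)] at this
  simp only [Os]; push_cast; linarith
lemma Os_le (Λ : ℝ) (s) : Os Λ s ≤ Ws s := by
  have hL : (0:ℝ) < Ls Λ s := by exact_mod_cast Ls_pos Λ s
  have h1 := OsL_le Λ s
  have h2 := Ls_ge Λ s
  have h3 : (0:ℝ) ≤ Ws s := by positivity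
  have : (Os Λ s : ℝ) ≤ Ws s := by
    have : (Os Λ s : ℝ) * Ls Λ s ≤ Ws s * Ls Λ s := by nlinarith
    exact le_of_mul_le_mul_right this hL
  exact_mod_cast this
lemma Ws_succ (s) : 4 * Ws s ≤ Ws (s+1) := by
  have : 4^(s^2) * 4 ≤ 4^((s+1)^2) := by
    rw [← pow_succ]; apply Nat.pow_le_pow_right (by norm_num)
    rw [add_sq]; omega
  simp only [Ws]; omega
lemma Ws_mono : StrictMono Ws := strictMono_nat_of_lt_succ (fun s => by have := Ws_succ s; have := Ws_pos s; omega)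
lemma sqrt_Ws (s) : √(2 * Ws s) = 2 * 2^(s^2) := by
  rw [Real.sqrt_eq_iff_mul_self_eq_of_pos (by positivity)]
  simp only [Ws]; push_cast
  rw [show (4:ℝ) = 2^2 by norm_num, ← pow_mul, mul_comm 2 (s^2), pow_mul]; ring



lemma poly_le_pow (c : ℝ) (k : ℕ) : ∀ᶠ s : ℕ in atTop, c * ((s:ℝ)+1)^k ≤ 2^(s^2) := by
  have h1 := tendsto_pow_const_div_const_pow_of_one_lt k (r := (2:ℝ)) (by norm_num)
  have h2 : ∀ᶠ n : ℕ in atTop, (n:ℝ)^k / 2^n < 1/(2*(|c|+1)) := h1.eventually_lt_const (by positivity)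
  have h3 := (tendsto_add_atTop_nat 1).eventually h2
  filter_upwards [h3, eventually_ge_atTop 1] with s hs hs1
  rw [div_lt_div_iff₀ (by positivity) (by positivity)] at hs
  push_cast at hs
  have h4 : (2:ℝ)^s ≤ 2^(s^2) := pow_le_pow_right₀ (by norm_num) (by nlinarith)
  have h5 : c * ((s:ℝ)+1)^k ≤ (|c|+1) * ((s:ℝ)+1)^k := by
    gcongr; linarith [le_abs_self c]
  rw [pow_succ] at hs
  nlinarith

/-- Window values. -/
noncomputable def gw (f : ℝ → ℝ) (x : ℝ) (s o : ℕ) : ℝ := f (((2*(Ws s + o) : ℕ):ℝ)*x)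

/-- Run sums of windows. -/
noncomputable def aseq (Λ : ℝ) (f : ℝ → ℝ) (x : ℝ) (s i : ℕ) : ℝ := blk (qs s) (Ls Λ s) (gw f x s) i

lemma gw_eq (f : ℝ → ℝ) (x : ℝ) (s o : ℕ) : gw f x s o = f (2*Ws s*x + o*(2*x)) := by
  simp only [gw]; congr 1; push_cast; ring

lemma L2norm_sq (f : ℝ → ℝ) : L2norm f ^ 2 = ∫ x in (0:ℝ)..1, (f x)^2 := by
  rw [L2norm, Real.sq_sqrt]
  apply intervalIntegral.integral_nonneg (by norm_num); intros; positivity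

section
variable {f v : ℝ → ℝ} {V x : ℝ}

lemma GoodFn.sq_asymp (h : GoodFn f v V) (h0 : (∫ x in (0:ℝ)..1, f x) = 0) (hx : DiophR x) :
    ∃ C, 0 ≤ C ∧ ∀ s M : ℕ, |∑ o ∈ range M, gw f x s o ^ 2 - M * L2norm f ^ 2| ≤ C * √M ∧
      |∑ o ∈ range M, gw f x s o| ≤ C * √M := by
  have hx2 := hx.two_mul
  obtain ⟨C1, hC1, h1⟩ := h.sqrt_bound h0 hx2
  have hsq := h.sq_sub (L2norm f ^ 2)
  have hi : (∫ x in (0:ℝ)..1, (f x ^ 2 - L2norm f ^ 2)) = 0 := by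
    rw [intervalIntegral.integral_sub]
    · rw [L2norm_sq]; simp
    · have := (h.sq_sub 0).intervalIntegrable 0 1
      simpa using this
    · simp
  obtain ⟨C2, hC2, h2⟩ := hsq.sqrt_bound hi hx2
  refine ⟨C1 + C2, by positivity, fun s M => ⟨?_, ?_⟩⟩
  · have := h2 M (2*Ws s*x)
    simp only [gw_eq]
    rw [Finset.sum_sub_distrib] at this
    simp only [Finset.sum_const, Finset.card_range, nsmul_eq_mul] at this
    refine this.trans ?_
    have := Real.sqrt_nonneg (M:ℝ); nlinarith
  · have := h1 M (2*Ws s*x)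
    simp only [gw_eq]
    refine this.trans ?_
    have := Real.sqrt_nonneg (M:ℝ); nlinarith

lemma L0_pos (Λ : ℝ) : (1:ℝ) ≤ L0 Λ := by simp [L0]

lemma Ls_le' (Λ : ℝ) (s : ℕ) : (Ls Λ s : ℝ) ≤ L0 Λ * ((s:ℝ)+1) := by
  have : (Ls Λ s : ℝ) ≤ s + L0 Λ := by exact_mod_cast Ls_le Λ s
  have h1 := L0_pos Λ
  have : (0:ℝ) ≤ s := by positivity
  nlinarith

lemma sqrt_Os_le (Λ : ℝ) (s : ℕ) : √(Os Λ s) ≤ 2 * 2^(s^2) := by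
  rw [← sqrt_Ws]
  apply Real.sqrt_le_sqrt
  have : (Os Λ s : ℝ) ≤ Ws s := by exact_mod_cast Os_le Λ s
  have : (0:ℝ) ≤ Ws s := by positivity
  linarith

lemma Ws_real (s : ℕ) : (Ws s : ℝ) = 2 * (2^(s^2))^2 := by
  simp only [Ws]; push_cast
  rw [show (4:ℝ) = 2^2 by norm_num, ← pow_mul, mul_comm 2 (s^2), pow_mul]

lemma GoodFn.var_upper (h : GoodFn f v V) (h0 : (∫ x in (0:ℝ)..1, f x) = 0) (hx : DiophR x)
    (Λ : ℝ) (δ : ℝ) (hδ : 0 < δ) : ∀ᶠ s : ℕ in atTop,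
    ∑ i ∈ range (Ks Λ s), aseq Λ f x s i ^ 2 ≤ 4 * (2*Ws s) * (Λ^2 * L2norm f ^2 + δ) := by
  obtain ⟨C, hC, hb⟩ := h.sq_asymp h0 hx
  filter_upwards [poly_le_pow (L0 Λ * C / (8*δ)) 1] with s hs
  have h1 := sum_blk_sq_le (qs s) (Ls Λ s) (qs_pos s) (Ls_pos Λ s) (gw f x s) (Js Λ s)
  have h2 := (abs_le.mp (hb s (Os Λ s)).1).2
  have h3 : (Ls Λ s:ℝ) * ∑ o ∈ range (Os Λ s), gw f x s o ^ 2 ≤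
     Ls Λ s * (Os Λ s * L2norm f ^2 + C * (2 * 2^(s^2))) := by
    gcongr
    have := mul_le_mul_of_nonneg_left (sqrt_Os_le Λ s) hC
    linarith
  refine (h1.trans h3).trans ?_
  have h4 := OsL_le Λ s
  have h5 : (Os Λ s:ℝ) * Ls Λ s * L2norm f ^2 ≤ 4 * Λ^2*(2*Ws s) * L2norm f ^2 := by gcongr
  have h6 := Ls_le' Λ s
  have h7 : Ls Λ s * C ≤ 8*δ * 2^(s^2) := by
    rw [div_mul_eq_mul_div, div_le_iff₀ (by positivity)] at hs
    have := mul_le_mul_of_nonneg_right h6 hC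
    nlinarith
  have h8 : (0:ℝ) < 2^(s^2) := by positivity
  have h9 := Ws_real s
  have h10 : Ls Λ s * C * (2 * 2^(s^2)) ≤ 8*δ * 2^(s^2) * (2 * 2^(s^2)) := by gcongr
  have h11 : 8*δ * 2^(s^2) * (2 * 2^(s^2)) = 4 * (2*Ws s) * δ := by rw [h9]; ring
  linarith

lemma GoodFn.var_lower (h : GoodFn f v V) (h0 : (∫ x in (0:ℝ)..1, f x) = 0) (hx : DiophR x)
    (Λ : ℝ) (ε : ℝ) (hε : 0 < ε) (q L : ℕ) (θ : ℝ) (p : ℤ)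
    (hp : |q*(2*x) - p| ≤ θ) (hθ : L * (|f 0|+V) * V * θ * Λ^2 ≤ ε/2) : ∀ᶠ s : ℕ in atTop,
    qs s = q → Ls Λ s = L →
    4 * (2*Ws s) * (Λ^2 * L2norm f ^2 - ε) ≤ ∑ i ∈ range (Ks Λ s), aseq Λ f x s i ^ 2 := by
  obtain ⟨C, hC, hb⟩ := h.sq_asymp h0 hx
  set B := |f 0| + V with hB
  have hV := h.V_nonneg
  have hB0 : 0 ≤ B := by positivity
  have hθ0 : 0 ≤ θ := (abs_nonneg _).trans hp
  set c1 := q * (L:ℝ)^2 * L2norm f ^2 + L^2*B*V*q with hc1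
  set c2 := L * C * 2 with hc2
  filter_upwards [poly_le_pow ((c1 + c2)/(8*ε)) 0] with s hs hqs hLs
  have hqp := qs_pos s
  have h1 := sum_blk_sq_ge (qs s) (Ls Λ s) (qs_pos s) (Ls_pos Λ s) (gw f x s) B (fun l => h.bdd _) (Js Λ s)
  have h2 := (abs_le.mp (hb s (Os Λ s)).1).1
  have hdiff : ∑ o ∈ range (qs s * Ls Λ s * Js Λ s), |gw f x s (o + qs s) - gw f x s o| ≤ V * (Os Λ s * θ + q) := by
    rw [mul_assoc, sum_range_mul_block, Finset.sum_comm]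
    have : ∀ r ∈ range (qs s), ∑ l ∈ range (Ls Λ s * Js Λ s), |gw f x s (qs s * l + r + qs s) - gw f x s (qs s * l + r)|
        ≤ V * ((Ls Λ s * Js Λ s : ℕ) * θ + 1) := by
      intro r _
      have := h.diff_sum (2*Ws s*x + r*(2*x)) (q*(2*x)) θ p hp (Ls Λ s * Js Λ s)
      refine le_trans (le_of_eq ?_) this
      apply Finset.sum_congr rfl; intro l _
      simp only [gw_eq]
      rw [hqs]
      congr 3 <;> · push_cast; ring_nf
    refine (Finset.sum_le_sum this).trans (le_of_eq ?_)
    simp only [Finset.sum_const, Finset.card_range, nsmul_eq_mul, Os]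
    push_cast; rw [hqs]; ring
  have h4 := OsL_le Λ s
  have h4' := OsL_ge Λ s
  rw [hLs] at h1 h4 h4'
  rw [hqs] at h4'
  have hLr : (0:ℝ) ≤ L := by positivity
  set X : ℝ := 2^(s^2) with hX
  have hX1 : 1 ≤ X := one_le_pow₀ (by norm_num)
  have h9 := Ws_real s
  rw [← hX] at h9
  have hsq : √(Os Λ s) ≤ 2 * X := sqrt_Os_le Λ s
  have e1 : (L:ℝ) * (Os Λ s * L2norm f ^2 - C * (2*X)) ≤ L * ∑ o ∈ range (Os Λ s), gw f x s o ^ 2 := by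
    gcongr
    have := mul_le_mul_of_nonneg_left hsq hC
    linarith
  have e2 : (L:ℝ)^2*B* ∑ o ∈ range (qs s * L * Js Λ s), |gw f x s (o + qs s) - gw f x s o| ≤ L^2*B*(V * (Os Λ s * θ + q)) := by
    rw [hLs] at hdiff
    gcongr
  have e3 : (4*Λ^2*(2*Ws s) - q * (L:ℝ)^2) * L2norm f ^2 ≤ (Os Λ s : ℝ) * L * L2norm f ^ 2 := by gcongr
  have e4 : L*B*V*θ*((Os Λ s : ℝ) * L) ≤ L*B*V*θ*(4*Λ^2*(2*Ws s)) := by gcongr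
  have e5 : L*B*V*θ*Λ^2 * (8 * Ws s) ≤ ε/2 * (8 * Ws s) := by gcongr
  have e6 : c1 + c2 * X ≤ 8*ε*X^2 := by
    rw [pow_zero, mul_one, div_le_iff₀ (by positivity)] at hs
    have hc10 : 0 ≤ c1 := by positivity
    have : c1 + c2*X ≤ (c1+c2)*X := by nlinarith
    nlinarith
  have hO : Os Λ s = qs s * L * Js Λ s := by rw [Os, hLs]
  rw [hO] at e1 e2 e3 e4
  simp only [Ks, aseq, hLs]
  refine le_trans ?_ h1
  have e7 : 4*(2*Ws s)*(Λ^2 * L2norm f^2 - ε) = 4*Λ^2*(2*Ws s)* L2norm f ^2 - ε * (8 * Ws s) := by ring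
  have e8 : ε/2 * (8 * Ws s) = 8*ε*X^2 := by rw [h9]; ring
  rw [hc1, hc2] at e6
  linarith

lemma GoodFn.countB (h : GoodFn f v V) (h0 : (∫ x in (0:ℝ)..1, f x) = 0) (hx : DiophR x)
    (Λ : ℝ) (hΛ : 0 ≤ Λ) (ε : ℝ) (hε : 0 < ε) : ∃ ρ : ℝ, 0 < ρ ∧ ∀ᶠ s : ℕ in atTop,
    ∑ e : Fin (Ks Λ s) → Bool, (if ∃ i ≤ Ks Λ s, 2*(Λ*L2norm f + ε) * Gs s ≤ |RS (aseq Λ f x s) e i| then (1:ℝ) else 0)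
      ≤ 2 ^ (Ks Λ s) * (2 * (s:ℝ)^(-(1+ρ))) := by
  have hσ : 0 ≤ L2norm f := Real.sqrt_nonneg _
  set A := Λ * L2norm f with hA
  have hA0 : 0 ≤ A := by positivity
  refine ⟨(A+ε)^2/(A^2+ε^2/2) - 1, ?_, ?_⟩
  · rw [sub_pos, lt_div_iff₀ (by positivity)]; nlinarith
  · filter_upwards [h.var_upper h0 hx Λ (ε^2/2) (by positivity), eventually_ge_atTop 2] with s hs hs2
    have hs2' : (2:ℝ) ≤ s := by exact_mod_cast hs2
    have hlog : 0 < log s := Real.log_pos (by linarith)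
    have hW : (0:ℝ) < Ws s := by exact_mod_cast Ws_pos s
    rw [← mul_pow, ← hA] at hs
    have := RS_maxabs (Ks Λ s) (aseq Λ f x s) (2*(A+ε)*Gs s) _ (by simp only [Gs]; positivity) (by positivity) hs
    refine this.trans (le_of_eq ?_)
    rw [Real.rpow_def_of_pos (by linarith)]
    rw [mul_assoc 2, mul_left_comm]
    congr 3
    rw [mul_pow, Gs, Real.sq_sqrt (by positivity)]
    field_simp
    ring

set_option maxHeartbeats 1000000 in
lemma GoodFn.countC (h : GoodFn f v V) (h0 : (∫ x in (0:ℝ)..1, f x) = 0) (hx : DiophR x)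
    (Λ : ℝ) (hΛ : 0 ≤ Λ) (hA : 0 < Λ * L2norm f) (ε : ℝ) (hε : 0 < ε) : ∃ q L : ℕ, 1 ≤ q ∧ L0 Λ ≤ L ∧
    8 * Λ^2 ≤ ε * L ∧ ∀ᶠ s : ℕ in atTop, qs s = q → Ls Λ s = L →
    2 ^ (Ks Λ s) * (s:ℝ)⁻¹ ≤ 
    ∑ e : Fin (Ks Λ s) → Bool, (if 2*(Λ*L2norm f - ε) * Gs s ≤ RS (aseq Λ f x s) e (Ks Λ s) then (1:ℝ) else 0) := by
  set A := Λ * L2norm f with hAdef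
  have hV := h.V_nonneg
  set B := |f 0| + V with hB
  have hB0 : 0 ≤ B := by positivity
  set τ := min (1/2) (ε/(2*A)) with hτ
  have hτ0 : 0 < τ := by rw [hτ]; positivity
  have hτ1 : τ ≤ 1/2 := min_le_left _ _
  have hτ2 : A * (2*τ) ≤ ε := by
    have : τ ≤ ε/(2*A) := min_le_right _ _
    rw [le_div_iff₀ (by positivity)] at this; linarith
  set L := max (L0 Λ) ⌈8*Λ^2/ε⌉₊ with hL
  have hLε : 8*Λ^2 ≤ ε * L := by
    have h1 : 8*Λ^2/ε ≤ L := (Nat.le_ceil _).trans (by exact_mod_cast le_max_right _ _)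
    rw [div_le_iff₀ hε] at h1; linarith
  set c := L * B * V * Λ^2 with hc
  have hc0 : 0 ≤ c := by positivity
  set n := ⌈2*c/(A^2*τ)⌉₊ + 1 with hn
  obtain ⟨q, hq0, hqn, hq⟩ := Real.exists_nat_abs_mul_sub_round_le (2*x) (n := n) (by omega)
  refine ⟨q, L, hq0, le_max_left _ _, hLε, ?_⟩
  have hθ : L * B * V * (1/((n:ℝ)+1)) * Λ^2 ≤ (A^2*τ)/2 := by
    have h1 : 2*c/(A^2*τ) ≤ (n:ℝ) + 1 := (Nat.le_ceil _).trans (by rw [hn]; push_cast; linarith)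
    rw [div_le_iff₀ (by positivity)] at h1
    have : L * B * V * (1/((n:ℝ)+1)) * Λ^2 = c / ((n:ℝ)+1) := by rw [hc]; ring
    rw [this, div_le_div_iff₀ (by positivity) (by norm_num)]
    linarith
  have hvl := h.var_lower h0 hx Λ (A^2*τ) (by positivity) q L _ _ hq hθ
  have hlog : ∀ᶠ s : ℕ in atTop, log 4 * 8/τ^2 ≤ log s :=
    (Real.tendsto_log_atTop.comp tendsto_natCast_atTop_atTop).eventually_ge_atTop _
  filter_upwards [hvl, hlog, eventually_ge_atTop 2, poly_le_pow ((L*B)^2/(A^2*τ^2)) 1] with s hs hlogs hs2 hpol hqs hLs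
  have hs := hs hqs hLs
  have hs2' : (2:ℝ) ≤ s := by exact_mod_cast hs2
  have hlog : 0 < log s := Real.log_pos (by linarith)
  have hW : (0:ℝ) < Ws s := by exact_mod_cast Ws_pos s
  rw [← mul_pow, ← hAdef] at hs
  have hpos : 0 < 4 * (2*Ws s) * (A^2 - A^2*τ) := by
    have : A^2*τ < A^2 := by nlinarith [sq_pos_of_pos hA]
    have : 0 < A^2 - A^2*τ := by linarith
    positivity
  set w := ∑ i ∈ range (Ks Λ s), aseq Λ f x s i ^ 2 with hw
  have hwpos : 0 < w := by linarith
  have hlow := RS_lower (Ks Λ s) (aseq Λ f x s) τ (log s) w hτ0 (by linarith) hwpos hw.symm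
    (by rw [div_le_iff₀ (by positivity)] at hlogs; linarith)
    (by
      intro j _
      have h1 : |aseq Λ f x s j| ≤ L * B := by
        have := blk_abs_le (qs s) (Ls Λ s) (gw f x s) B (fun l => h.bdd _) j
        rw [hLs] at this; simpa [aseq, hLs] using this
      have h2 : aseq Λ f x s j ^ 2 ≤ (L*B)^2 := by
        rw [← sq_abs]; gcongr
      have h3 : log s ≤ s + 1 := by
        have := Real.log_le_sub_one_of_pos (show (0:ℝ) < s by linarith)
        linarith
      have h4 : aseq Λ f x s j ^ 2 * log s ≤ (L*B)^2 * (s+1) := by gcongr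
      refine h4.trans ?_
      rw [pow_one, div_mul_eq_mul_div, div_le_iff₀ (by positivity)] at hpol
      have hWX : (2:ℝ)^(s^2) ≤ Ws s := by
        rw [Ws_real]
        have : (1:ℝ) ≤ 2^(s^2) := one_le_pow₀ (by norm_num)
        nlinarith
      have h5 : 4 * (Ws s) * A^2 ≤ w := by
        have : A^2 * (1/2) ≤ A^2 - A^2*τ := by nlinarith [sq_nonneg A]
        have h6 : 4 * (2*Ws s) * (A^2 * (1/2)) ≤ 4 * (2*Ws s) * (A^2 - A^2*τ) := by gcongr
        linarith
      have h6 : 2^(s^2) * (A^2*τ^2) ≤ Ws s * (A^2*τ^2) := by gcongr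
      have h7 : 4 * (Ws s) * A^2 * τ^2 ≤ w * τ^2 := by gcongr
      linarith)
  have e1 : exp (-log s) = (s:ℝ)⁻¹ := by rw [exp_neg, Real.exp_log (by linarith)]
  rw [e1, mul_comm] at hlow
  refine hlow.trans ?_
  apply Finset.sum_le_sum; intro e _
  have hkey : 2*(A-ε)*Gs s ≤ (1-τ)*√(2*w*log s) := by
    have h1 : 2*(A*(1-τ))*Gs s ≤ √(2*w*log s) := by
      apply Real.le_sqrt_of_sq_le
      rw [mul_pow, Gs, Real.sq_sqrt (by positivity)]
      have h2 : 4 * (2*Ws s) * (A^2 * (1-τ)^2) ≤ w := by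
        have : A^2*(1-τ)^2 ≤ A^2 - A^2*τ := by
          have h8 : 0 ≤ A^2*(τ*(1-τ)) := mul_nonneg (sq_nonneg A) (mul_nonneg hτ0.le (by linarith))
          have h9 : A^2 - A^2*τ - A^2*(1-τ)^2 = A^2*(τ*(1-τ)) := by ring
          linarith
        have h6 : 4 * (2*Ws s) * (A^2 * (1-τ)^2) ≤ 4 * (2*Ws s) * (A^2 - A^2*τ) := by gcongr
        linarith
      have h3 : 4 * (2*Ws s) * (A^2 * (1-τ)^2) * (2*log s) ≤ w * (2*log s) := by gcongr
      linarith
    have h2 : (1-τ) * (2*(A*(1-τ))*Gs s) ≤ (1-τ)*√(2*w*log s) := by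
      apply mul_le_mul_of_nonneg_left h1; linarith
    refine le_trans ?_ h2
    have hG : 0 ≤ Gs s := Real.sqrt_nonneg _
    have : A - ε ≤ A*(1-τ)^2 := by
      have h8 := mul_nonneg hA.le (sq_nonneg τ)
      have h9 : A*(1-τ)^2 = A - A*(2*τ) + A*τ^2 := by ring
      linarith
    have := mul_le_mul_of_nonneg_right this hG
    linarith
  split_ifs with h1 h2
  · norm_num
  · exact absurd (hkey.trans h1) h2
  · norm_num
  · norm_num
end



/-- Independent fair coins. -/
noncomputable def coinM (K : ℕ → ℕ) : Measure (∀ s, Fin (K s) → Bool) :=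
  Measure.infinitePi (fun s => (ProbabilityTheory.uniformOn (Set.univ : Set (Fin (K s) → Bool))))

instance (K : ℕ → ℕ) : IsProbabilityMeasure (coinM K) := by
  unfold coinM; infer_instance

lemma coin_real (K : ℕ → ℕ) (s : ℕ) (E : Set (Fin (K s) → Bool)) [DecidablePred (· ∈ E)] :
    2 ^ (K s) * (coinM K).real {ω | ω s ∈ E} = ∑ e : Fin (K s) → Bool, if e ∈ E then (1:ℝ) else 0 := by
  have h1 : coinM K {ω | ω s ∈ E} = ProbabilityTheory.uniformOn (Set.univ : Set (Fin (K s) → Bool)) E := by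
    have := (_root_.measurePreserving_eval_infinitePi
      (fun s => (ProbabilityTheory.uniformOn (Set.univ : Set (Fin (K s) → Bool)))) s).measure_preimage
      (s := E) (Set.toFinite E).measurableSet.nullMeasurableSet
    exact this
  rw [measureReal_def, h1, ProbabilityTheory.uniformOn_univ]
  rw [← Finset.sum_filter, Measure.count_apply (Set.toFinite E).measurableSet]
  rw [Set.encard_eq_coe_toFinset_card]
  simp
  field_simp

lemma coin_BC1 (K : ℕ → ℕ) (E : ∀ s, Set (Fin (K s) → Bool)) [∀ s, DecidablePred (· ∈ E s)]
    (p : ℕ → ℝ) (hp : Summable p)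
    (h : ∀ᶠ s in atTop, ∑ e : Fin (K s) → Bool, (if e ∈ E s then (1:ℝ) else 0) ≤ 2 ^ (K s) * p s) :
    ∀ᵐ ω ∂(coinM K), ∀ᶠ s in atTop, ω s ∉ E s := by
  obtain ⟨s0, hs0⟩ := eventually_atTop.mp h
  have hE : ∀ s, s0 ≤ s → coinM K {ω | ω s ∈ E s} ≤ ENNReal.ofReal (p s) := by
    intro s hs
    have h1 := hs0 s hs
    rw [← coin_real] at h1
    have h2 := le_of_mul_le_mul_left h1 (by positivity)
    rw [measureReal_def] at h2
    exact (ENNReal.le_ofReal_iff_toReal_le (measure_ne_top _ _) (ENNReal.toReal_nonneg.trans h2)).mpr h2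
  have key := ae_eventually_notMem (μ := coinM K) (s := fun s => if s0 ≤ s then {ω | ω s ∈ E s} else ∅) (by
    apply ne_top_of_le_ne_top hp.tsum_ofReal_ne_top
    apply ENNReal.tsum_le_tsum
    intro s
    split_ifs with hs
    · exact hE s hs
    · simp)
  filter_upwards [key] with ω hω
  filter_upwards [hω, eventually_ge_atTop s0] with s h1 h2
  simpa [h2] using h1

lemma coin_BC2 (K : ℕ → ℕ) (E : ∀ s, Set (Fin (K s) → Bool)) [∀ s, DecidablePred (· ∈ E s)]
    (p : ℕ → ℝ) (hp0 : ∀ s, 0 ≤ p s) (hp : ¬ Summable p)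
    (h : ∀ᶠ s in atTop, 2 ^ (K s) * p s ≤ ∑ e : Fin (K s) → Bool, (if e ∈ E s then (1:ℝ) else 0)) :
    ∀ᵐ ω ∂(coinM K), ∃ᶠ s in atTop, ω s ∈ E s := by
  have hm : ∀ s, MeasurableSet {ω : ∀ s, Fin (K s) → Bool | ω s ∈ E s} := fun s =>
    measurable_pi_apply s (Set.toFinite (E s)).measurableSet
  have hind : ProbabilityTheory.iIndepSet (fun s => {ω : ∀ s, Fin (K s) → Bool | ω s ∈ E s}) (coinM K) := by
    rw [ProbabilityTheory.iIndepSet_iff_meas_biInter hm]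
    intro S
    have := ProbabilityTheory.iIndepFun_infinitePi
      (P := fun s => (ProbabilityTheory.uniformOn (Set.univ : Set (Fin (K s) → Bool))))
      (X := fun s e => e) (fun s => measurable_id)
    rw [ProbabilityTheory.iIndepFun_iff_measure_inter_preimage_eq_mul] at this
    exact this S (sets := E) (fun i _ => (Set.toFinite (E i)).measurableSet)
  have hsum : ∑' s, coinM K {ω | ω s ∈ E s} = ⊤ := by
    by_contra hne
    have h1 := ENNReal.summable_toReal hne
    apply hp
    refine Summable.of_norm_bounded_eventually_nat h1 ?_
    filter_upwards [h] with s hs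
    rw [← coin_real] at hs
    have h2 := le_of_mul_le_mul_left hs (by positivity)
    rw [Real.norm_of_nonneg (hp0 s)]
    exact h2
  have h1 := ProbabilityTheory.measure_limsup_eq_one hm hind hsum
  have h2 : MeasurableSet (limsup (fun s => {ω : ∀ s, Fin (K s) → Bool | ω s ∈ E s}) atTop) :=
    MeasurableSet.measurableSet_limsup hm
  have h3 := (prob_compl_eq_zero_iff h2).mpr h1
  rw [← mem_ae_iff] at h3
  filter_upwards [h3] with ω hω
  rw [mem_limsup_iff_frequently_mem] at hω
  exact hω

lemma type_not_summable (Λ : ℝ) (q L : ℕ) (hq : 1 ≤ q) (hL : L0 Λ ≤ L) :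
    ¬ Summable (fun s : ℕ => if qs s = q ∧ Ls Λ s = L then (s:ℝ)⁻¹ else 0) := by
  intro h
  set i := Nat.pair (q-1) (L - L0 Λ) with hi
  have hinj : Function.Injective (fun u : ℕ => 2^i*(2*u+1)) := by
    intro a b hab
    have := Nat.eq_of_mul_eq_mul_left (by positivity) hab
    omega
  have hv : ∀ u : ℕ, padicValNat 2 (2^i*(2*u+1)) = i := by
    intro u
    rw [padicValNat.mul (by positivity) (by omega), padicValNat.prime_pow,
      padicValNat.eq_zero_of_not_dvd (by omega)]
    rfl
  have h1 := h.comp_injective hinj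
  have h2 : ∀ u : ℕ, ((2:ℝ)^(i+1))⁻¹ * (1/((u:ℝ)+1)) ≤ ((fun s : ℕ => if qs s = q ∧ Ls Λ s = L then (s:ℝ)⁻¹ else 0) ∘ (fun u : ℕ => 2^i*(2*u+1))) u := by
    intro u
    have e : qs (2^i*(2*u+1)) = q ∧ Ls Λ (2^i*(2*u+1)) = L := by
      simp only [qs, Ls, hv u]
      simp only [hi, Nat.unpair_pair]; omega
    simp only [Function.comp]
    rw [if_pos e, one_div, ← mul_inv]
    push_cast
    apply inv_anti₀ (by positivity)
    have : (0:ℝ) < 2^i := by positivity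
    rw [pow_succ]; nlinarith
  have h3 := Summable.of_nonneg_of_le (fun u => by positivity) h2 h1
  rw [summable_mul_left_iff (by positivity)] at h3
  have h4 := (summable_nat_add_iff (f := fun n : ℕ => 1/(n:ℝ)) 1).mp (by simpa using h3)
  exact Real.not_summable_one_div_natCast h4

/-- The good event. -/
def GoodEv (Λ : ℝ) (f : ℝ → ℝ) (x : ℝ) (ω : ∀ s, Fin (Ks Λ s) → Bool) : Prop :=
  (∀ m : ℕ, ∀ᶠ s in atTop, ∀ i, i ≤ Ks Λ s →
    |RS (aseq Λ f x s) (ω s) i| < 2*(Λ*L2norm f + 1/((m:ℝ)+1)) * Gs s) ∧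
  (0 < Λ * L2norm f → ∀ m : ℕ, ∃ᶠ s in atTop,
    2*(Λ*L2norm f - 1/((m:ℝ)+1)) * Gs s ≤ RS (aseq Λ f x s) (ω s) (Ks Λ s) ∧
      8*Λ^2 ≤ 1/((m:ℝ)+1) * Ls Λ s)

lemma goodEv_ae {f v : ℝ → ℝ} {V x : ℝ} (h : GoodFn f v V) (h0 : (∫ x in (0:ℝ)..1, f x) = 0) (hx : DiophR x)
    (Λ : ℝ) (hΛ : 0 ≤ Λ) : ∀ᵐ ω ∂(coinM (Ks Λ)), GoodEv Λ f x ω := by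
  classical
  have hB : ∀ᵐ ω ∂(coinM (Ks Λ)), ∀ m : ℕ, ∀ᶠ s in atTop, ∀ i, i ≤ Ks Λ s →
    |RS (aseq Λ f x s) (ω s) i| < 2*(Λ*L2norm f + 1/((m:ℝ)+1)) * Gs s := by
    rw [ae_all_iff]; intro m
    obtain ⟨ρ, hρ, hc⟩ := h.countB h0 hx Λ hΛ (1/((m:ℝ)+1)) (by positivity)
    have hs : Summable (fun s : ℕ => 2 * (s:ℝ)^(-(1+ρ))) :=
      (Real.summable_nat_rpow.mpr (by linarith)).mul_left 2
    have := coin_BC1 (Ks Λ) (fun s => {e | ∃ i ≤ Ks Λ s, 2*(Λ*L2norm f + (1/((m:ℝ)+1))) * Gs s ≤ |RS (aseq Λ f x s) e i|})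
      _ hs hc
    filter_upwards [this] with ω hω
    filter_upwards [hω] with s hs i hi
    by_contra hcon
    exact hs ⟨i, hi, not_lt.mp hcon⟩
  have hC : ∀ᵐ ω ∂(coinM (Ks Λ)), (0 < Λ * L2norm f → ∀ m : ℕ, ∃ᶠ s in atTop,
    2*(Λ*L2norm f - 1/((m:ℝ)+1)) * Gs s ≤ RS (aseq Λ f x s) (ω s) (Ks Λ s) ∧
      8*Λ^2 ≤ 1/((m:ℝ)+1) * Ls Λ s) := by
    rw [eventually_imp_distrib_left]; intro hA
    rw [ae_all_iff]; intro m
    obtain ⟨q, L, hq, hL, hLe, hc⟩ := h.countC h0 hx Λ hΛ hA (1/((m:ℝ)+1)) (by positivity)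
    have := coin_BC2 (Ks Λ) (fun s => {e | (qs s = q ∧ Ls Λ s = L) ∧
      2*(Λ*L2norm f - (1/((m:ℝ)+1))) * Gs s ≤ RS (aseq Λ f x s) e (Ks Λ s)})
      (fun s : ℕ => if qs s = q ∧ Ls Λ s = L then (s:ℝ)⁻¹ else 0)
      (fun s => by split_ifs <;> positivity) (type_not_summable Λ q L hq hL)
      (by
        filter_upwards [hc] with s hs
        by_cases ht : qs s = q ∧ Ls Λ s = L
        · simp only [ht, true_and, if_true, and_self]
          have := hs ht.1 ht.2
          rw [ht.2] at *
          exact this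
        · simp [ht])
    filter_upwards [this] with ω hω
    refine hω.mono ?_
    rintro s ⟨⟨h1, h2⟩, h3⟩
    exact ⟨h3, by rw [h2]; exact hLe⟩
  filter_upwards [hB, hC] with ω h1 h2 using ⟨h1, h2⟩

lemma measurableSet_ev {α : Type*} [MeasurableSpace α] {p : ℕ → α → Prop}
    (h : ∀ s, MeasurableSet {a | p s a}) : MeasurableSet {a | ∀ᶠ s in atTop, p s a} := by
  have : {a | ∀ᶠ s in atTop, p s a} = liminf (fun s => {a | p s a}) atTop := by
    ext a; rw [mem_liminf_iff_eventually_mem]; rfl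
  rw [this]; exact MeasurableSet.measurableSet_liminf h

lemma measurableSet_fr {α : Type*} [MeasurableSpace α] {p : ℕ → α → Prop}
    (h : ∀ s, MeasurableSet {a | p s a}) : MeasurableSet {a | ∃ᶠ s in atTop, p s a} := by
  have : {a | ∃ᶠ s in atTop, p s a} = limsup (fun s => {a | p s a}) atTop := by
    ext a; rw [mem_limsup_iff_frequently_mem]; rfl
  rw [this]; exact MeasurableSet.measurableSet_limsup h

lemma ms_and {α : Type*} [MeasurableSpace α] {p q : α → Prop} (h1 : MeasurableSet {a | p a})
    (h2 : MeasurableSet {a | q a}) : MeasurableSet {a | p a ∧ q a} := by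
  have : {a | p a ∧ q a} = {a | p a} ∩ {a | q a} := by ext a; simp
  rw [this]; exact h1.inter h2

lemma ms_all {α : Type*} [MeasurableSpace α] {ι : Sort*} [Countable ι] {p : ι → α → Prop}
    (h : ∀ i, MeasurableSet {a | p i a}) : MeasurableSet {a | ∀ i, p i a} := by
  have : {a | ∀ i, p i a} = ⋂ i, {a | p i a} := by ext a; simp
  rw [this]; exact MeasurableSet.iInter h

lemma meas_RS (Λ : ℝ) (f : ℝ → ℝ) (hf : Measurable f) (s i : ℕ) :
    Measurable (fun z : ℝ × (∀ s, Fin (Ks Λ s) → Bool) => RS (aseq Λ f z.1 s) (z.2 s) i) := by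
  unfold RS
  apply Finset.measurable_sum; intro j _
  split_ifs
  · apply Measurable.mul
    · have h1 : Measurable sg := measurable_of_countable _
      have h2 : Measurable (fun z : ℝ × (∀ s, Fin (Ks Λ s) → Bool) => z.2 s j) :=
        (measurable_pi_apply j).comp ((measurable_pi_apply s).comp measurable_snd)
      exact h1.comp h2
    · unfold aseq blk gw
      apply Finset.measurable_sum; intro l _
      exact hf.comp (measurable_const.mul measurable_fst)
  · exact measurable_const

lemma meas_goodEv (Λ : ℝ) (f : ℝ → ℝ) (hf : Measurable f) :
    MeasurableSet {z : ℝ × (∀ s, Fin (Ks Λ s) → Bool) | GoodEv Λ f z.1 z.2} := by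
  have hR := meas_RS Λ f hf
  unfold GoodEv
  apply ms_and
  · apply ms_all; intro m
    apply measurableSet_ev; intro s
    apply ms_all; intro i
    apply ms_all; intro hi
    exact measurableSet_lt ((hR s i).norm) measurable_const
  · apply ms_all; intro hA
    apply ms_all; intro m
    apply measurableSet_fr; intro s
    apply ms_and
    · exact measurableSet_le measurable_const (hR s _)
    · exact MeasurableSet.const _

lemma exists_omega (Λ : ℝ) (hΛ : 0 ≤ Λ) (𝓕 : Set (ℝ → ℝ)) (hcount : 𝓕.Countable)
    (hF : ∀ f ∈ 𝓕, (∀ x : ℝ, f (x + 1) = f x) ∧ (∫ x in (0:ℝ)..1, f x) = 0 ∧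
      BoundedVariationOn f (Set.Icc 0 1)) :
    ∃ ω : ∀ s, Fin (Ks Λ s) → Bool, ∀ f ∈ 𝓕, ∀ᵐ x : ℝ, GoodEv Λ f x ω := by
  have : ∀ᵐ ω ∂(coinM (Ks Λ)), ∀ f ∈ 𝓕, ∀ᵐ x : ℝ, GoodEv Λ f x ω := by
    rw [ae_ball_iff hcount]
    intro f hf
    obtain ⟨hp, h0, hb⟩ := hF f hf
    obtain ⟨v, V, hG⟩ := GoodFn.exists_of_bv hp hb
    rw [← Measure.ae_ae_comm (meas_goodEv Λ f hG.measurable)]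
    filter_upwards [ae_dioph] with x hx
    exact goodEv_ae hG h0 hx Λ hΛ
  exact this.exists



lemma sum_nth_count (p : ℕ → Prop) [DecidablePred p] (F : ℕ → ℝ) (n : ℕ) :
    ∑ j ∈ range (Nat.count p n), F (Nat.nth p j) = ∑ m ∈ range n, if p m then F m else 0 := by
  induction n with
  | zero => simp
  | succ n ih =>
    rw [Nat.count_succ, Finset.sum_range_succ]
    split_ifs with h
    · rw [Finset.sum_range_succ, ih, Nat.nth_count h]
    · simpa using ih

section
variable (Λ : ℝ) (ω : ∀ s, Fin (Ks Λ s) → Bool)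

/-- Coins with natural index. -/
noncomputable def coin (s i : ℕ) : Bool := if h : i < Ks Λ s then ω s ⟨i, h⟩ else false

/-- Halves of deleted numbers. -/
def del2 (w : ℕ) : Prop := ∃ s o, o < Os Λ s ∧ w = Ws s + o ∧ coin Λ ω s (ridx (qs s) (Ls Λ s) o) = true

/-- Kept numbers. -/
def keep (n : ℕ) : Prop := 0 < n ∧ ¬ (Even n ∧ del2 Λ ω (n/2))

noncomputable instance instDecDel2 : DecidablePred (del2 Λ ω) := Classical.decPred _
noncomputable instance instDecKeep : DecidablePred (keep Λ ω) := Classical.decPred _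

lemma keep_odd (w : ℕ) : keep Λ ω (2*w+1) := ⟨by omega, fun h => by
  have := h.1; rw [Nat.even_add_one] at this; exact this (even_two_mul w)⟩

lemma not_del2_zero : ¬ del2 Λ ω 0 := by
  rintro ⟨s, o, _, h, _⟩
  have := Ws_pos s; omega

lemma keep_even (w : ℕ) (hw : 0 < w) : keep Λ ω (2*w) ↔ ¬ del2 Λ ω w := by
  simp only [keep]
  rw [show 2*w/2 = w by omega]
  simp; omega

lemma del2_window (s o : ℕ) (ho : o < Os Λ s) :
    del2 Λ ω (Ws s + o) ↔ coin Λ ω s (ridx (qs s) (Ls Λ s) o) = true := by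
  constructor
  · rintro ⟨s', o', ho', he, hc⟩
    have h1 := Os_le Λ s
    have h2 := Os_le Λ s'
    have h3 := Ws_succ s
    have h4 := Ws_succ s'
    have h5 : Ws s < Ws (s'+1) := by omega
    have h6 : Ws s' < Ws (s+1) := by omega
    have h7 := Ws_mono.lt_iff_lt.mp h5
    have h8 := Ws_mono.lt_iff_lt.mp h6
    have : s = s' := by omega
    subst this
    have : o = o' := by omega
    subst this
    exact hc
  · intro h; exact ⟨s, o, ho, rfl, h⟩

lemma not_del2_window (s w : ℕ) (h1 : Ws s + Os Λ s ≤ w) (h2 : w < Ws (s+1)) : ¬ del2 Λ ω w := by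
  rintro ⟨s', o', ho', he, hc⟩
  have h3 := Os_le Λ s'
  have h4 := Ws_succ s'
  have h5 : Ws s < Ws (s'+1) := by omega
  have h6 : Ws s' < Ws (s+1) := by omega
  have h7 := Ws_mono.lt_iff_lt.mp h5
  have h8 := Ws_mono.lt_iff_lt.mp h6
  have : s = s' := by omega
  subst this
  omega

/-- Deleted sums. -/
noncomputable def EE (F : ℕ → ℝ) (w : ℕ) : ℝ := ∑ w' ∈ range w, if del2 Λ ω w' then F (2*w') else 0

/-- Window deleted sums. -/
noncomputable def DW (F : ℕ → ℝ) (s o : ℕ) : ℝ :=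
  ∑ o' ∈ range o, if coin Λ ω s (ridx (qs s) (Ls Λ s) o') = true then F (2*(Ws s + o')) else 0

lemma EE_window (F : ℕ → ℝ) (s w : ℕ) (h1 : Ws s ≤ w) (h2 : w ≤ Ws (s+1)) :
    EE Λ ω F w = EE Λ ω F (Ws s) + DW Λ ω F s (min (w - Ws s) (Os Λ s)) := by
  obtain ⟨d, rfl⟩ := Nat.exists_eq_add_of_le h1
  have key : ∀ o ≤ Os Λ s, ∑ o' ∈ range o, (if del2 Λ ω (Ws s + o') then F (2*(Ws s + o')) else 0) = DW Λ ω F s o := by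
    intro o ho
    apply Finset.sum_congr rfl
    intro o' ho'
    simp only [del2_window Λ ω s o' (lt_of_lt_of_le (Finset.mem_range.mp ho') ho)]
  rw [EE, Finset.sum_range_add, ← EE, Nat.add_sub_cancel_left]
  congr 1
  rcases le_total d (Os Λ s) with h | h
  · rw [min_eq_left h, key d h]
  · rw [min_eq_right h]
    obtain ⟨r, rfl⟩ := Nat.exists_eq_add_of_le h
    rw [Finset.sum_range_add, key _ le_rfl]
    have : ∑ x ∈ range r, (if del2 Λ ω (Ws s + (Os Λ s + x)) then F (2*(Ws s + (Os Λ s + x))) else 0) = 0 := by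
      apply Finset.sum_eq_zero
      intro o ho
      rw [if_neg]
      have := Finset.mem_range.mp ho
      exact not_del2_window Λ ω s _ (by omega) (by omega)
    rw [this, add_zero]

lemma keep_sum (F : ℕ → ℝ) (w : ℕ) :
    ∑ m ∈ range (2*w), (if keep Λ ω m then F m else 0)
      = ∑ m ∈ range (2*w), F m - (if 0 < w then F 0 else 0) - EE Λ ω F w := by
  induction w with
  | zero => simp [EE]
  | succ w ih =>
    rw [show 2*(w+1) = 2*w+1+1 by ring, Finset.sum_range_succ, Finset.sum_range_succ, ih,
      Finset.sum_range_succ, Finset.sum_range_succ, if_pos (keep_odd Λ ω w), EE, EE, Finset.sum_range_succ]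
    rcases Nat.eq_zero_or_pos w with h | h
    · subst h
      have : ¬ keep Λ ω 0 := by simp [keep]
      simp [this, not_del2_zero]
    · simp only [keep_even Λ ω w h, h]
      by_cases hd : del2 Λ ω w <;> simp [hd] <;> ring

lemma keep_count_ge (w : ℕ) : w ≤ Nat.count (keep Λ ω) (2*w) := by
  induction w with
  | zero => simp
  | succ w ih =>
    rw [show 2*(w+1) = 2*w+1+1 by ring, Nat.count_succ, Nat.count_succ, if_pos (keep_odd Λ ω w)]
    omega

lemma keep_count_window (s : ℕ) : 2 * Ws (s+1) ≤ Nat.count (keep Λ ω) (2 * Ws (s+1)) + 2 * Ws s + 1 := by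
  have h := sum_nth_count (keep Λ ω) (fun _ => 1) (2 * Ws (s+1))
  rw [keep_sum] at h
  simp only [Finset.sum_const, Finset.card_range, nsmul_eq_mul, mul_one] at h
  rw [if_pos (Ws_pos _)] at h
  have h2 : EE Λ ω (fun _ => 1) (Ws (s+1)) ≤ 2 * Ws s := by
    have hO := Os_le Λ s
    have hs := Ws_succ s
    have e : Ws (s+1) = (Ws s + Os Λ s) + (Ws (s+1) - (Ws s + Os Λ s)) := by omega
    have z : ∑ x ∈ range (Ws (s+1) - (Ws s + Os Λ s)), (if del2 Λ ω ((Ws s + Os Λ s) + x) then (1:ℝ) else 0) = 0 := by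
      apply Finset.sum_eq_zero
      intro o ho
      rw [if_neg]
      have := Finset.mem_range.mp ho
      exact not_del2_window Λ ω s _ (by omega) (by omega)
    rw [EE, e, Finset.sum_range_add, z, add_zero]
    refine (Finset.sum_le_sum (g := fun _ => (1:ℝ)) (fun i _ => by split_ifs <;> norm_num)).trans ?_
    simp only [Finset.sum_const, Finset.card_range, nsmul_eq_mul, mul_one]
    have : (Os Λ s : ℝ) ≤ Ws s := by exact_mod_cast hO
    push_cast; linarith
  have : (2 * Ws (s+1) : ℝ) ≤ Nat.count (keep Λ ω) (2 * Ws (s+1)) + 2 * Ws s + 1 := by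
    push_cast at h; linarith
  exact_mod_cast this

/-- The sequence. -/
noncomputable def nseq (k : ℕ) : ℕ := Nat.nth (keep Λ ω) (k-1)

lemma keep_infinite : (Set.ofPred (keep Λ ω)).Infinite := by
  apply Set.infinite_of_injective_forall_mem (f := fun w : ℕ => 2*w+1)
  · intro a b h; simp at h; exact h
  · intro w; exact keep_odd Λ ω w

lemma nseq_keep (k : ℕ) : keep Λ ω (nseq Λ ω k) := Nat.nth_mem_of_infinite (keep_infinite Λ ω) _

lemma nseq_lt (k : ℕ) (hk : 1 ≤ k) : nseq Λ ω k < nseq Λ ω (k+1) :=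
  Nat.nth_strictMono (keep_infinite Λ ω) (by omega)

lemma nseq_gap (k : ℕ) (hk : 1 ≤ k) : nseq Λ ω (k+1) - nseq Λ ω k = 1 ∨ nseq Λ ω (k+1) - nseq Λ ω k = 2 := by
  have h1 := nseq_lt Λ ω k hk
  have h2 : nseq Λ ω (k+1) ≤ nseq Λ ω k + 2 := by
    have : ∃ m, nseq Λ ω k < m ∧ m ≤ nseq Λ ω k + 2 ∧ keep Λ ω m := by
      rcases Nat.even_or_odd' (nseq Λ ω k) with ⟨c, hc | hc⟩
      · exact ⟨2*c+1, by omega, by omega, keep_odd Λ ω c⟩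
      · exact ⟨2*(c+1)+1, by omega, by omega, keep_odd Λ ω _⟩
    obtain ⟨m, hm1, hm2, hm⟩ := this
    refine le_trans ?_ hm2
    have e : Nat.nth (keep Λ ω) (Nat.count (keep Λ ω) m) = m := Nat.nth_count hm
    have : k ≤ Nat.count (keep Λ ω) m := by
      have : Nat.count (keep Λ ω) (nseq Λ ω k) < Nat.count (keep Λ ω) m :=
        Nat.count_strict_mono (nseq_keep Λ ω k) hm1
      have h3 : Nat.count (keep Λ ω) (nseq Λ ω k) = k - 1 := Nat.count_nth_of_infinite (keep_infinite Λ ω) _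
      omega
    rw [← e]
    exact Nat.nth_monotone (keep_infinite Λ ω) (by simpa using this)
  omega

lemma nseq_sum (F : ℕ → ℝ) (n : ℕ) :
    ∑ k ∈ Finset.Icc 1 (Nat.count (keep Λ ω) n), F (nseq Λ ω k) = ∑ m ∈ range n, if keep Λ ω m then F m else 0 := by
  rw [← sum_nth_count]
  generalize Nat.count (keep Λ ω) n = N
  induction N with
  | zero => simp
  | succ N ih =>
    rw [Finset.sum_Icc_succ_top (by omega), ih, Finset.sum_range_succ]
    rfl
end



lemma poly_le_two_pow (c : ℝ) : ∀ᶠ s : ℕ in atTop, c * ((s:ℝ)+1) ≤ 2^s := by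
  have h1 := tendsto_pow_const_div_const_pow_of_one_lt 1 (r := (2:ℝ)) (by norm_num)
  have h2 : ∀ᶠ n : ℕ in atTop, (n:ℝ)^1 / 2^n < 1/(2*(|c|+1)) := h1.eventually_lt_const (by positivity)
  have h3 := (tendsto_add_atTop_nat 1).eventually h2
  filter_upwards [h3] with s hs
  rw [div_lt_div_iff₀ (by positivity) (by positivity)] at hs
  push_cast at hs
  have h5 : c * ((s:ℝ)+1) ≤ (|c|+1) * ((s:ℝ)+1) := by
    gcongr; linarith [le_abs_self c]
  rw [pow_one, pow_succ] at hs
  linarith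

lemma Gs_eq (s : ℕ) : Gs s = 2 * 2^(s^2) * √(2 * log s) := by
  rw [← sqrt_Ws, ← Real.sqrt_mul (by positivity), Gs]
  congr 1; ring

lemma Gs_nonneg (s : ℕ) : 0 ≤ Gs s := Real.sqrt_nonneg _

lemma small_Gs (C η : ℝ) (hη : 0 < η) : ∀ᶠ s : ℕ in atTop, C * 2^(s^2) ≤ η * Gs s := by
  have h1 : Tendsto (fun s : ℕ => √(2 * log s)) atTop atTop :=
    Real.tendsto_sqrt_atTop.comp ((Real.tendsto_log_atTop.comp tendsto_natCast_atTop_atTop).const_mul_atTop (by norm_num))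
  filter_upwards [h1.eventually_ge_atTop (C/(2*η))] with s hs
  rw [Gs_eq]
  rw [div_le_iff₀ (by positivity)] at hs
  have : (0:ℝ) < 2^(s^2) := by positivity
  nlinarith

lemma Gs_le (s : ℕ) : Gs s ≤ 2 * 2^(s^2) * ((s:ℝ)+1) := by
  rw [Gs_eq]; gcongr
  apply Real.sqrt_le_iff.mpr
  refine ⟨by positivity, ?_⟩
  have := Real.log_le_self (show (0:ℝ) ≤ s by positivity)
  nlinarith

section
variable {f v : ℝ → ℝ} {V x : ℝ}

lemma DW_approx (h : GoodFn f v V) (h0 : (∫ x in (0:ℝ)..1, f x) = 0) (hx : DiophR x)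
    (Λ : ℝ) (ω : ∀ s, Fin (Ks Λ s) → Bool) :
    ∃ C, 0 ≤ C ∧ ∀ᶠ s in atTop, ∀ o ≤ Os Λ s,
      |DW Λ ω (fun m => f (m*x)) s o - 1/2 * RS (aseq Λ f x s) (ω s) (qs s * (o/(qs s * Ls Λ s)))| ≤ C * 2^(s^2) := by
  obtain ⟨C, hC, hb⟩ := h.sq_asymp h0 hx
  have hV := h.V_nonneg
  set B := |f 0| + V with hB
  have hB0 : 0 ≤ B := by positivity
  refine ⟨C + 1, by positivity, ?_⟩
  filter_upwards [poly_le_pow (L0 Λ * B) 2] with s hs o ho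
  set c : ℕ → ℝ := fun i => sg (coin Λ ω s i) with hc
  have h1 := sum_partial (qs s) (Ls Λ s) (qs_pos s) (Ls_pos Λ s) (gw f x s) c B (fun l => h.bdd _)
    (fun l => by simp only [hc, sg]; split_ifs <;> simp) o
  have hi : qs s * (o/(qs s * Ls Λ s)) ≤ Ks Λ s := by
    simp only [Ks]
    apply Nat.mul_le_mul_left
    apply Nat.div_le_of_le_mul
    exact ho
  have h2 : RS (aseq Λ f x s) (ω s) (qs s * (o/(qs s * Ls Λ s))) =
      ∑ i ∈ range (qs s * (o/(qs s * Ls Λ s))), c i * blk (qs s) (Ls Λ s) (gw f x s) i := by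
    apply RS_eq_sum _ _ _ hi
    intro j; simp [hc, coin]
  rw [← h2] at h1
  have h3 : DW Λ ω (fun m => f (m*x)) s o = 1/2 * ∑ o' ∈ range o, gw f x s o' +
      1/2 * ∑ o' ∈ range o, c (ridx (qs s) (Ls Λ s) o') * gw f x s o' := by
    rw [Finset.mul_sum, Finset.mul_sum, ← Finset.sum_add_distrib]
    apply Finset.sum_congr rfl
    intro o' _
    simp only [hc, sg, gw]
    split_ifs
    · push_cast; ring
    · push_cast; ring
  have h4 := (hb s o).2
  have h5 : √(o:ℝ) ≤ 2 * 2^(s^2) := by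
    refine le_trans (Real.sqrt_le_sqrt ?_) (sqrt_Os_le Λ s)
    exact_mod_cast ho
  have h6 : (qs s : ℝ) * Ls Λ s * B ≤ 2^(s^2) := by
    have e1 : (qs s:ℝ) ≤ s + 1 := by exact_mod_cast qs_le s
    have e2 := Ls_le' Λ s
    have : (qs s : ℝ) * Ls Λ s * B ≤ ((s:ℝ)+1) * (L0 Λ * ((s:ℝ)+1)) * B := by gcongr
    nlinarith
  rw [h3]
  have h7 := mul_le_mul_of_nonneg_left h5 hC
  have h8 : (0:ℝ) < 2^(s^2) := by positivity
  rw [abs_le] at h1 h4 ⊢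
  constructor <;> nlinarith [h1.1, h1.2, h4.1, h4.2]

lemma E_bound (h : GoodFn f v V) (h0 : (∫ x in (0:ℝ)..1, f x) = 0) (hx : DiophR x)
    (Λ : ℝ) (hΛ : 0 ≤ Λ) (ω : ∀ s, Fin (Ks Λ s) → Bool) (hG : GoodEv Λ f x ω) :
    ∃ c, ∀ᶠ s in atTop, |EE Λ ω (fun m => f (m*x)) (Ws s)| ≤ c * 2^(s^2) := by
  obtain ⟨C, hC, hD⟩ := DW_approx h h0 hx Λ ω
  have hB := hG.1 0
  have hA : 0 ≤ Λ * L2norm f := mul_nonneg hΛ (Real.sqrt_nonneg _)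
  set A := Λ * L2norm f with hAdef
  have hev : ∀ᶠ s in atTop, |DW Λ ω (fun m => f (m*x)) s (Os Λ s)| ≤ 2^((s+1)^2) / 2 := by
    filter_upwards [hD, hB, poly_le_two_pow (2*(A+1)+C)] with s h1 h2 h3
    have h1 := h1 _ le_rfl
    have hi : qs s * (Os Λ s/(qs s * Ls Λ s)) ≤ Ks Λ s := by
      simp only [Ks]
      apply Nat.mul_le_mul_left
      apply Nat.div_le_of_le_mul
      exact le_rfl
    have h2 := h2 _ hi
    have h4 := Gs_le s
    set X : ℝ := 2^(s^2) with hX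
    have hX0 : 0 < X := by positivity
    have e : (2:ℝ)^((s+1)^2) = X * (2^s * 2^s * 2) := by
      rw [hX, ← pow_add, ← pow_succ, ← pow_add]; congr 1; ring
    have h5 : (1:ℝ) ≤ 2^s := one_le_pow₀ (by norm_num)
    have h6 : |DW Λ ω (fun m => f (m*x)) s (Os Λ s)| ≤ (A+1) * Gs s + C * X := by
      norm_num at h2
      rw [abs_lt] at h2; rw [abs_le] at h1 ⊢
      constructor <;> linarith [h1.1, h1.2, h2.1, h2.2]
    refine h6.trans ?_
    rw [e]
    have h7 : (A+1) * Gs s ≤ (A+1) * (2 * X * ((s:ℝ)+1)) := by gcongr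
    have h8 : C * X ≤ C * X * ((s:ℝ)+1) := by
      have : (0:ℝ) ≤ s := by positivity
      have : 0 ≤ C * X := by positivity
      nlinarith
    have h9 : X * ((2*(A+1)+C) * ((s:ℝ)+1)) ≤ X * 2^s := by gcongr
    have h10 : X * 2^s ≤ X * (2^s * 2^s) := by
      gcongr; nlinarith
    linarith
  obtain ⟨s0, hs0⟩ := eventually_atTop.mp hev
  refine ⟨max 1 |EE Λ ω (fun m => f (m*x)) (Ws s0)|, eventually_atTop.mpr ⟨s0, fun s hs => ?_⟩⟩
  set c := max 1 |EE Λ ω (fun m => f (m*x)) (Ws s0)| with hc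
  have hc1 : 1 ≤ c := le_max_left _ _
  induction s, hs using Nat.le_induction with
  | base =>
    have h1 : (1:ℝ) ≤ 2^(s0^2) := one_le_pow₀ (by norm_num)
    have h2 : |EE Λ ω (fun m => f (m*x)) (Ws s0)| ≤ c := le_max_right _ _
    nlinarith
  | succ s hs ih =>
    have h1 := EE_window Λ ω (fun m => f (m*x)) s (Ws (s+1)) (Ws_mono (Nat.lt_succ_self s)).le le_rfl
    have h2 : min (Ws (s+1) - Ws s) (Os Λ s) = Os Λ s := by
      have := Ws_succ s; have := Os_le Λ s; omega
    rw [h2] at h1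
    rw [h1]
    refine (abs_add_le _ _).trans ?_
    have h3 := hs0 s hs
    have h4 : (2:ℝ) * 2^(s^2) ≤ 2^((s+1)^2) := by
      rw [← pow_succ']; apply pow_le_pow_right₀ (by norm_num); rw [add_sq]; omega
    have h5 : (0:ℝ) < 2^((s+1)^2) := by positivity
    nlinarith
end



lemma Gs_sq (s : ℕ) : Gs s = √((2 * Ws s) * (2 * log s)) := by
  rw [Gs]; congr 1; ring

lemma Gs_le_norm (η : ℝ) (hη : 0 < η) : ∀ᶠ s : ℕ in atTop, ∀ N : ℕ,
    2 * Ws (s+1) ≤ N + 2 * Ws s + 1 → Gs (s+1) ≤ (1+η) * √(N * log (log N)) := by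
  filter_upwards [poly_le_two_pow (3*(1+η)/(2*η))] with s hs N hN
  have hW : (1:ℝ) ≤ Ws s := by exact_mod_cast Ws_pos s
  have hN' : (2:ℝ) * Ws (s+1) ≤ N + 2 * Ws s + 1 := by exact_mod_cast hN
  have hWW : (2:ℝ)^s * Ws s ≤ Ws (s+1) := by
    rw [Ws_real, Ws_real]
    have e : (2:ℝ)^((s+1)^2) = 2^(s^2) * (2^s * 2^s * 2) := by
      rw [← pow_add, ← pow_succ, ← pow_add]; congr 1; ring
    rw [e]
    have h1 : (1:ℝ) ≤ 2^s := one_le_pow₀ (by norm_num)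
    have h2 : (2:ℝ)^s ≤ (2^s*2^s*2)^2 := by
      have : (2:ℝ)^s ≤ 2^s*2^s*2 := by nlinarith
      nlinarith
    have h3 : (0:ℝ) ≤ 2 * (2^(s^2))^2 := by positivity
    nlinarith
  have h4 : 3*(1+η) * Ws s ≤ 2*η*Ws (s+1) := by
    have h5 : 3*(1+η)/(2*η) ≤ 2^s := by
      refine le_trans ?_ hs
      have : (0:ℝ) ≤ s := by positivity
      have : 0 ≤ 3*(1+η)/(2*η) := by positivity
      nlinarith
    rw [div_le_iff₀ (by positivity)] at h5
    nlinarith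
  have h6 : (2:ℝ) * Ws (s+1) ≤ (1+η) * N := by nlinarith
  have hWN : (Ws (s+1) : ℝ) ≤ N := by
    have := Ws_succ s
    have h8 : Ws (s+1) ≤ N := by have := Ws_pos s; omega
    exact_mod_cast h8
  have h7 : ((s+1:ℕ):ℝ)^2 ≤ log N := by
    have hp : (0:ℝ) < N := lt_of_lt_of_le (by exact_mod_cast Ws_pos _) hWN
    rw [Real.le_log_iff_exp_le hp]
    refine le_trans ?_ hWN
    rw [Ws]
    push_cast
    have h9 : Real.exp (((s:ℝ)+1)^2) = Real.exp 1 ^ ((s+1)^2) := by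
      rw [← Real.exp_nat_mul]; push_cast; ring_nf
    rw [h9]
    have h10 : Real.exp 1 ^ ((s+1)^2) ≤ (4:ℝ)^((s+1)^2) := by
      gcongr; linarith [Real.exp_one_lt_d9]
    have : (0:ℝ) < (4:ℝ)^((s+1)^2) := by positivity
    linarith
  have h8 : 2 * log ((s+1:ℕ):ℝ) ≤ log (log N) := by
    have : 2 * log ((s+1:ℕ):ℝ) = log (((s+1:ℕ):ℝ)^2) := by rw [Real.log_pow]; norm_num
    rw [this]
    apply Real.log_le_log (by positivity) h7
  have h0 : 0 ≤ log ((s+1:ℕ):ℝ) := Real.log_natCast_nonneg _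
  rw [Gs_sq]
  rw [Real.sqrt_le_iff]
  refine ⟨by positivity, ?_⟩
  have h11 : 0 ≤ (N:ℝ) * log (log N) := mul_nonneg (by positivity) (by linarith)
  rw [mul_pow, Real.sq_sqrt h11]
  calc _ ≤ ((1+η) * N) * log (log N) := by
        apply mul_le_mul h6 h8 (by positivity) (by positivity)
    _ ≤ _ := by
        have h12 := mul_nonneg hη.le h11
        have h13 := mul_nonneg hη.le h12
        linarith

lemma norm_le_Gs (η : ℝ) (hη : 0 < η) (hη1 : η ≤ 1) : ∀ᶠ s : ℕ in atTop, ∀ N : ℕ,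
    Ws s ≤ N → (N:ℝ) ≤ 2 * Ws s * (1+η) → √(N * log (log N)) ≤ (1+η) * Gs s := by
  have h1 : Tendsto (fun s : ℕ => log (s:ℝ)) atTop atTop :=
    Real.tendsto_log_atTop.comp tendsto_natCast_atTop_atTop
  filter_upwards [h1.eventually_ge_atTop (log 3 / (2*η)), eventually_ge_atTop 2] with s hs hs2 N hN1 hN2
  rw [div_le_iff₀ (by positivity)] at hs
  have hs2' : (2:ℝ) ≤ s := by exact_mod_cast hs2
  have hW : (1:ℝ) ≤ Ws s := by exact_mod_cast Ws_pos s
  have hW8 : (8:ℝ) ≤ Ws s := by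
    rw [Ws_real]
    have : (2:ℝ)^1 ≤ 2^(s^2) := by
      apply pow_le_pow_right₀ (by norm_num); nlinarith
    nlinarith
  have hN1' : (Ws s:ℝ) ≤ N := by exact_mod_cast hN1
  have hp : (0:ℝ) < N := by linarith
  have hlog : log N ≤ 3 * (s:ℝ)^2 := by
    have : (N:ℝ) ≤ 2^(2*s^2+3) := by
      have e : (2:ℝ)^(2*s^2+3) = 4 * Ws s := by
        rw [Ws_real]; ring
      rw [e]; nlinarith
    have h3 := Real.log_le_log hp this
    rw [Real.log_pow] at h3
    push_cast at h3
    have := Real.log_two_lt_d9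
    have h5 : (2 * (s:ℝ)^2+3) * log 2 ≤ (2 * (s:ℝ)^2+3) * 1 := by gcongr; linarith
    nlinarith
  have hlog1 : 1 < log N := by
    rw [Real.lt_log_iff_exp_lt hp]
    linarith [Real.exp_one_lt_d9]
  have hll : log (log N) ≤ 2 * log s * (1+η) := by
    have h3 := Real.log_le_log (by linarith) hlog
    rw [Real.log_mul (by norm_num) (by positivity), Real.log_pow] at h3
    push_cast at h3
    nlinarith
  rw [Gs_sq, ← Real.sqrt_sq (show 0 ≤ 1+η by linarith), ← Real.sqrt_mul (by positivity)]
  apply Real.sqrt_le_sqrt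
  have h0 : 0 ≤ log (log N) := Real.log_nonneg hlog1.le
  calc (N:ℝ) * log (log N) ≤ (2 * Ws s * (1+η)) * (2 * log s * (1+η)) :=
        mul_le_mul hN2 hll h0 (by positivity)
    _ = _ := by ring

lemma tendsto_loglog : Tendsto (fun N : ℕ => log (log (N:ℝ))) atTop atTop :=
  Real.tendsto_log_atTop.comp (Real.tendsto_log_atTop.comp tendsto_natCast_atTop_atTop)

lemma small_norm (C η : ℝ) (hη : 0 < η) : ∀ᶠ N : ℕ in atTop, C * √N ≤ η * √(N * log (log N)) := by
  filter_upwards [(Real.tendsto_sqrt_atTop.comp tendsto_loglog).eventually_ge_atTop (C/η)] with N hN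
  simp only [Function.comp] at hN
  rw [div_le_iff₀ hη] at hN
  rw [Real.sqrt_mul (by positivity)]
  have := Real.sqrt_nonneg (N:ℝ)
  nlinarith

lemma exists_window (w s0 : ℕ) (h : Ws s0 ≤ w) : ∃ s, s0 ≤ s ∧ Ws s ≤ w ∧ w < Ws (s+1) := by
  have hb : ∀ s, Ws s ≤ w → s ≤ w := fun s hs => (Ws_mono.le_apply).trans hs
  refine ⟨Nat.findGreatest (fun s => Ws s ≤ w) w, Nat.le_findGreatest (hb _ h) h,
    Nat.findGreatest_spec (P := fun s => Ws s ≤ w) (hb _ h) h, ?_⟩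
  by_contra hc
  push Not at hc
  have := Nat.le_findGreatest (P := fun s => Ws s ≤ w) (hb _ hc) hc
  omega

section
variable {f v : ℝ → ℝ} {V x : ℝ}

lemma T_bound (h : GoodFn f v V) (h0 : (∫ x in (0:ℝ)..1, f x) = 0) (hx : DiophR x)
    (Λ : ℝ) (ω : ∀ s, Fin (Ks Λ s) → Bool) :
    ∃ C, 0 ≤ C ∧ ∀ w : ℕ, 1 ≤ w → 
      |∑ m ∈ range (2*w), (if keep Λ ω m then f (m*x) else 0) + EE Λ ω (fun m => f (m*x)) w| ≤ C * √w := by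
  obtain ⟨C, hC, hb⟩ := h.sqrt_bound h0 hx
  refine ⟨2*C + |f 0|, by positivity, fun w hw => ?_⟩
  have h1 := hb (2*w) 0
  have h2 := keep_sum Λ ω (fun m => f (m*x)) w
  rw [if_pos (by omega)] at h2
  simp only [zero_add] at h1
  simp only [Nat.cast_zero, zero_mul] at h2
  rw [h2]
  have hw1 : (1:ℝ) ≤ √w := by
    rw [Real.one_le_sqrt]; exact_mod_cast hw
  have hw2 : √((2*w:ℕ):ℝ) ≤ 2 * √w := by
    rw [Real.sqrt_le_iff]
    refine ⟨by positivity, ?_⟩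
    rw [mul_pow, Real.sq_sqrt (by positivity)]; push_cast
    have : (0:ℝ) ≤ w := by positivity
    linarith
  have h3 : C * √((2*w:ℕ):ℝ) ≤ C * (2 * √w) := by gcongr
  have h4 : |f 0| ≤ |f 0| * √w := le_mul_of_one_le_right (abs_nonneg _) hw1
  calc _ = |∑ m ∈ range (2*w), f (m*x) - f 0| := by congr 1; ring
    _ ≤ |∑ m ∈ range (2*w), f (m*x)| + |f 0| := abs_sub _ _
    _ ≤ _ := by linarith

lemma upper (h : GoodFn f v V) (h0 : (∫ x in (0:ℝ)..1, f x) = 0) (hx : DiophR x)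
    (Λ : ℝ) (hΛ : 0 ≤ Λ) (ω : ∀ s, Fin (Ks Λ s) → Bool) (hG : GoodEv Λ f x ω) (A' : ℝ)
    (hA' : Λ * L2norm f < A') :
    ∀ᶠ N : ℕ in atTop, |∑ k ∈ Finset.Icc 1 N, f ((nseq Λ ω k : ℝ) * x)| ≤
      A' * √(N * log (log N)) := by
  obtain ⟨C, hC, hD⟩ := DW_approx h h0 hx Λ ω
  obtain ⟨c, hE⟩ := E_bound h h0 hx Λ hΛ ω hG
  obtain ⟨C1, hC1, hT⟩ := T_bound h h0 hx Λ ω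
  have hA : 0 ≤ Λ * L2norm f := mul_nonneg hΛ (Real.sqrt_nonneg _)
  have hV := h.V_nonneg
  set A := Λ * L2norm f with hAdef
  set B := |f 0| + V with hB
  have hB0 : 0 ≤ B := by positivity
  obtain ⟨η, hη, hη1, hηA⟩ : ∃ η : ℝ, 0 < η ∧ η ≤ 1 ∧ η * (A + 5) ≤ A' - A := by
    refine ⟨min 1 ((A'-A)/(A+5)), lt_min one_pos (div_pos (by linarith) (by linarith)), min_le_left _ _, ?_⟩
    rw [← le_div_iff₀ (by linarith)]; exact min_le_right _ _
  obtain ⟨m, hm⟩ := exists_nat_one_div_lt hη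
  have hev : ∀ᶠ s : ℕ in atTop, (∀ N : ℕ, 2 * Ws s ≤ N + 2 * Ws (s-1) + 1 → Gs s ≤ (1+η) * √(N * log (log N))) := by
    obtain ⟨s1, hs1⟩ := eventually_atTop.mp (Gs_le_norm η hη)
    filter_upwards [eventually_ge_atTop (s1+1)] with s hs
    obtain ⟨t, rfl⟩ : ∃ t, s = t+1 := ⟨s-1, by omega⟩
    exact hs1 t (by omega)
  obtain ⟨s0, hs0⟩ := eventually_atTop.mp
    (((hD.and hE).and (hG.1 m)).and ((small_Gs (C+c) η hη).and (hev.and (eventually_ge_atTop 1))))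
  filter_upwards [small_norm (C1 + B) η hη, eventually_ge_atTop (2 * Ws s0 + 2)] with N hN1 hN2
  set n := Nat.nth (keep Λ ω) N with hn
  have hcount : Nat.count (keep Λ ω) n = N := Nat.count_nth_of_infinite (keep_infinite Λ ω) N
  have hNn : N ≤ n := by
    have h1 : Nat.count (keep Λ ω) n ≤ n := Nat.count_le _
    omega
  have hsum := nseq_sum Λ ω (fun m => f (m*x)) n
  rw [hcount] at hsum
  rw [hsum]
  obtain ⟨s, hs, hw1, hw2⟩ := exists_window (n/2) s0 (by omega)
  set w := n/2 with hw
  obtain ⟨⟨⟨hD, hE⟩, hR⟩, hsm, hGs, hs1⟩ := hs0 s hs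
  have hwpos : 1 ≤ w := by omega
  have hwN : w ≤ N := by
    rw [← hcount]
    exact (keep_count_ge Λ ω w).trans (Nat.count_monotone _ (by omega))
  have hGN := hGs N (by
    obtain ⟨t, rfl⟩ : ∃ t, s = t+1 := ⟨s-1, by omega⟩
    have h1 := keep_count_window Λ ω t
    have h2 : Nat.count (keep Λ ω) (2 * Ws (t+1)) ≤ N := by
      rw [← hcount]; exact Nat.count_monotone _ (by omega)
    simp only [Nat.add_sub_cancel]
    omega)
  have hTn : |∑ m ∈ range n, (if keep Λ ω m then f (m*x) else 0)| ≤
      |∑ m ∈ range (2*w), (if keep Λ ω m then f (m*x) else 0)| + B := by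
    rcases (show n = 2*w ∨ n = 2*w+1 by omega) with h1 | h1
    · rw [h1]; linarith
    · rw [h1, Finset.sum_range_succ]
      refine (abs_add_le _ _).trans ?_
      gcongr
      split_ifs
      · exact h.bdd _
      · simpa using hB0
  have hT := hT w hwpos
  have hEw := EE_window Λ ω (fun m => f (m*x)) s w hw1 hw2.le
  set o := min (w - Ws s) (Os Λ s) with ho
  have hoO : o ≤ Os Λ s := min_le_right _ _
  have hD := hD o hoO
  have hi : qs s * (o/(qs s * Ls Λ s)) ≤ Ks Λ s := by
    simp only [Ks]
    apply Nat.mul_le_mul_left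
    apply Nat.div_le_of_le_mul
    exact hoO
  have hR := hR _ hi
  have hsw : √(w:ℝ) ≤ √N := Real.sqrt_le_sqrt (by exact_mod_cast hwN)
  have hN1' : (1:ℝ) ≤ √N := by
    rw [Real.one_le_sqrt]; exact_mod_cast (by omega : 1 ≤ N)
  have hCw : C1 * √w ≤ C1 * √N := by gcongr
  have hBN : B ≤ B * √N := le_mul_of_one_le_right hB0 hN1'
  have hG0 := Gs_nonneg s
  set X := √(N * log (log N)) with hX
  have hX0 : 0 ≤ X := Real.sqrt_nonneg _
  set D := DW Λ ω (fun m => f (m*x)) s o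
  set R := RS (aseq Λ f x s) (ω s) (qs s * (o/(qs s * Ls Λ s)))
  set E := EE Λ ω (fun m => f (m*x)) w
  set E0 := EE Λ ω (fun m => f (m*x)) (Ws s)
  set T := ∑ m ∈ range (2*w), (if keep Λ ω m then f (m*x) else 0)
  have hR2 : 2*(A + 1/((m:ℝ)+1))*Gs s ≤ 2*(A+η)*Gs s := by gcongr
  have hTE : |T| ≤ C1 * √N + |E| := by
    have : |T| ≤ |T + E| + |E| := by
      have := abs_sub (T+E) E
      simpa using this
    linarith
  have hEE : |E| ≤ (A+2*η) * Gs s := by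
    rw [hEw]
    rw [abs_le] at hD hE ⊢
    rw [abs_lt] at hR
    constructor <;> linarith [hD.1, hD.2, hE.1, hE.2, hR.1, hR.2]
  have hfin : (A+2*η) * Gs s ≤ (A+2*η) * ((1+η)*X) := by gcongr
  have : (A+2*η)*(1+η) + η ≤ A' := by nlinarith
  have : ((A+2*η)*(1+η) + η) * X ≤ A' * X := by gcongr
  linarith

lemma lower (h : GoodFn f v V) (h0 : (∫ x in (0:ℝ)..1, f x) = 0) (hx : DiophR x)
    (Λ : ℝ) (hΛ : 0 ≤ Λ) (ω : ∀ s, Fin (Ks Λ s) → Bool) (hG : GoodEv Λ f x ω) (A' : ℝ)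
    (hA'0 : 0 ≤ A') (hA' : A' < Λ * L2norm f) :
    ∃ᶠ N : ℕ in atTop, A' * √(N * log (log N)) ≤ |∑ k ∈ Finset.Icc 1 N, f ((nseq Λ ω k : ℝ) * x)| := by
  obtain ⟨C, hC, hD⟩ := DW_approx h h0 hx Λ ω
  obtain ⟨c, hE⟩ := E_bound h h0 hx Λ hΛ ω hG
  obtain ⟨C1, hC1, hT⟩ := T_bound h h0 hx Λ ω
  set A := Λ * L2norm f with hAdef
  obtain ⟨η, hη, hη1, hηA⟩ : ∃ η : ℝ, 0 < η ∧ η ≤ 1 ∧ η * (A' + 2) ≤ A - A' := by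
    refine ⟨min 1 ((A-A')/(A'+2)), lt_min one_pos (div_pos (by linarith) (by linarith)), min_le_left _ _, ?_⟩
    rw [← le_div_iff₀ (by linarith)]; exact min_le_right _ _
  obtain ⟨m, hm⟩ := exists_nat_one_div_lt hη
  have hfr := hG.2 (by linarith) m
  have hNt : Tendsto (fun s => Nat.count (keep Λ ω) (2 * (Ws s + Os Λ s))) atTop atTop := by
    refine tendsto_atTop_mono (fun s => ?_) Ws_mono.tendsto_atTop
    exact (Nat.le_add_right _ _).trans (keep_count_ge Λ ω _)
  refine hNt.frequently ?_
  refine (hfr.and_eventually (((hD.and hE).and (small_Gs (C+c+2*C1) η hη)).and (norm_le_Gs η hη hη1))).mono ?_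
  rintro s ⟨⟨hR, hL⟩, ⟨⟨hD, hE⟩, hsm⟩, hnorm⟩
  rw [nseq_sum Λ ω (fun m => f (m*x))]
  have hOL := OsL_le Λ s
  have hOW := Os_le Λ s
  have hWS := Ws_succ s
  have hWp := Ws_pos s
  set w := Ws s + Os Λ s with hw
  set N := Nat.count (keep Λ ω) (2*w) with hN
  have hG0 := Gs_nonneg s
  have hnorm := hnorm N ((Nat.le_add_right _ _).trans (keep_count_ge Λ ω _)) (by
    have h1 : N ≤ 2*w := Nat.count_le _
    have h2 : (N:ℝ) ≤ 2 * (Ws s + Os Λ s) := by exact_mod_cast h1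
    have h3 : 8*Λ^2 ≤ η * Ls Λ s := hL.trans (by gcongr)
    have hLp : (0:ℝ) < Ls Λ s := by exact_mod_cast Ls_pos Λ s
    have hWp' : (0:ℝ) < Ws s := by exact_mod_cast hWp
    have h4 : (Os Λ s:ℝ) * Ls Λ s ≤ (η * Ws s) * Ls Λ s := by nlinarith
    have h5 := le_of_mul_le_mul_right h4 hLp
    linarith)
  have hT := hT w (by omega)
  have hEw := EE_window Λ ω (fun m => f (m*x)) s w (Nat.le_add_right _ _) (by omega)
  rw [show min (w - Ws s) (Os Λ s) = Os Λ s by omega] at hEw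
  have hD := hD _ le_rfl
  have hidx : qs s * (Os Λ s / (qs s * Ls Λ s)) = Ks Λ s := by
    rw [Os, Ks, Nat.mul_div_cancel_left _ (Nat.mul_pos (qs_pos s) (Ls_pos Λ s))]
  rw [hidx] at hD
  have hsw : √(w:ℝ) ≤ 2 * 2^(s^2) := by
    rw [← sqrt_Ws]; apply Real.sqrt_le_sqrt
    have : w ≤ 2 * Ws s := by omega
    exact_mod_cast this
  have hCw : C1 * √w ≤ C1 * (2 * 2^(s^2)) := by gcongr
  set X := √(N * log (log N)) with hX
  have hX0 : 0 ≤ X := Real.sqrt_nonneg _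
  set D := DW Λ ω (fun m => f (m*x)) s (Os Λ s)
  set R := RS (aseq Λ f x s) (ω s) (Ks Λ s)
  set E := EE Λ ω (fun m => f (m*x)) w
  set E0 := EE Λ ω (fun m => f (m*x)) (Ws s)
  set T := ∑ m ∈ range (2*w), (if keep Λ ω m then f (m*x) else 0)
  have hR2 : 2*(A - η)*Gs s ≤ 2*(A - 1/((m:ℝ)+1))*Gs s := by gcongr
  have hTT : (A-2*η) * Gs s ≤ |T| := by
    refine le_trans ?_ (neg_le_abs T)
    rw [abs_le] at hD hE hT
    linarith [hD.1, hD.2, hE.1, hE.2, hT.1, hT.2]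
  refine le_trans ?_ hTT
  have h1 : A' * X ≤ A' * ((1+η) * Gs s) := by gcongr
  have h2 : (A' * (1+η)) * Gs s ≤ (A-2*η) * Gs s := by
    apply mul_le_mul_of_nonneg_right _ hG0; linarith
  linarith

lemma limsup_final (h : GoodFn f v V) (h0 : (∫ x in (0:ℝ)..1, f x) = 0) (hx : DiophR x)
    (Λ : ℝ) (hΛ : 0 ≤ Λ) (ω : ∀ s, Fin (Ks Λ s) → Bool) (hG : GoodEv Λ f x ω) :
    Filter.atTop.limsup (fun N : ℕ =>
            ((|∑ k ∈ Finset.Icc 1 N, f ((nseq Λ ω k : ℝ) * x)| /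
              Real.sqrt (N * Real.log (Real.log N)) : ℝ) : EReal))
          = ((Λ * L2norm f : ℝ) : EReal) := by
  have hpos : ∀ᶠ N : ℕ in atTop, 0 < √(N * log (log (N:ℝ))) := by
    filter_upwards [tendsto_loglog.eventually_gt_atTop 0, eventually_gt_atTop 0] with N h1 h2
    apply Real.sqrt_pos.mpr
    have : (0:ℝ) < N := by exact_mod_cast h2
    positivity
  have hA : 0 ≤ Λ * L2norm f := mul_nonneg hΛ (Real.sqrt_nonneg _)
  apply le_antisymm
  · apply EReal.le_of_forall_lt_iff_le.mp
    intro z hz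
    have hz' : Λ * L2norm f < z := by exact_mod_cast hz
    apply limsup_le_of_le
    · isBoundedDefault
    filter_upwards [hpos, upper h h0 hx Λ hΛ ω hG z hz'] with N h1 h2
    rw [EReal.coe_le_coe_iff, div_le_iff₀ h1]
    exact h2
  · apply EReal.ge_of_forall_gt_iff_ge.mp
    intro z hz
    have hz' : z < Λ * L2norm f := by exact_mod_cast hz
    apply le_limsup_of_frequently_le
    swap
    · isBoundedDefault
    rcases lt_or_ge z 0 with hz0 | hz0
    · apply Eventually.frequently
      filter_upwards with N
      rw [EReal.coe_le_coe_iff]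
      exact hz0.le.trans (by positivity)
    · refine ((lower h h0 hx Λ hΛ ω hG z hz0 hz').and_eventually hpos).mono ?_
      rintro N ⟨h1, h2⟩
      rw [EReal.coe_le_coe_iff, le_div_iff₀ h2]
      exact h1
end

/-- **Theorem 1 (countable class).** For any `Λ ≥ 0` and any countable class `𝓕` of 1-periodic
functions with zero mean and bounded variation on `[0,1]`, there is a strictly increasing
sequence of positive integers with gaps in `{1,2}` such that for every `f ∈ 𝓕` the limsup in
the LIL equals `Λ‖f‖` almost everywhere. -/
theorem lil_bounded_gaps_countable_class
    (Λ : ℝ) (hΛ : 0 ≤ Λ) (𝓕 : Set (ℝ → ℝ)) (hcount : 𝓕.Countable)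
    (hF : ∀ f ∈ 𝓕, (∀ x : ℝ, f (x + 1) = f x) ∧ (∫ x in (0:ℝ)..1, f x) = 0 ∧
      BoundedVariationOn f (Set.Icc 0 1)) :
    ∃ n : ℕ → ℕ,
      (∀ k, 1 ≤ k → 0 < n k) ∧
      (∀ k, 1 ≤ k → n k < n (k + 1)) ∧
      (∀ k, 1 ≤ k → n (k + 1) - n k = 1 ∨ n (k + 1) - n k = 2) ∧
      (∀ f ∈ 𝓕, ∀ᵐ x ∂(volume : Measure ℝ),
        Filter.atTop.limsup (fun N : ℕ =>
            ((|∑ k ∈ Finset.Icc 1 N, f ((n k : ℝ) * x)| /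
              Real.sqrt (N * Real.log (Real.log N)) : ℝ) : EReal))
          = ((Λ * L2norm f : ℝ) : EReal)) := by
  obtain ⟨ω, hω⟩ := exists_omega Λ hΛ 𝓕 hcount hF
  refine ⟨nseq Λ ω, fun k _ => (nseq_keep Λ ω k).1, nseq_lt Λ ω, nseq_gap Λ ω, fun f hf => ?_⟩
  obtain ⟨hp, h0, hb⟩ := hF f hf
  obtain ⟨v, V, hgood⟩ := GoodFn.exists_of_bv hp hb
  filter_upwards [hω f hf, ae_dioph] with x hx1 hx2
  exact limsup_final hgood h0 hx2 Λ hΛ ω hx1
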